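/- In U = U_q(A(0,2)^{(4)})^+: (a) for all m, n ≥ 1, L̄_{2m}L̄_{2n} = L̄_{2n}L̄_{2m}; (c) for all n ≥ 0: for every j ≥ 1, L̄_{4j} commutes with M_{2n+1} (L̄_{4j}M_{2n+1} = M_{2n+1}L̄_{4j}), and for every j ≥ 0, L̄_{4j+2}M_{2n+1} − M_{2n+1}L̄_{4j+2} = (1/2^{2j})·([2j+1]_q/(2j+1))·M_{4j+2n+3}, where [m]_q = (q^m − q^{−m})/(q − q⁻¹). -/

import Mathlib

noncomputable section

namespace QAff

abbrev F : Type := FreeAlgebra ℂ (Fin 2)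

def x1 : F := FreeAlgebra.ι ℂ 0
def x2 : F := FreeAlgebra.ι ℂ 1

def θ (q : ℂ) : ℂ := q - q⁻¹

def L1F (q : ℂ) : F := x1 * x2 - q⁻¹ • (x2 * x1)

def X2F (q : ℂ) : F := x1 * L1F q - L1F q * x1

def Y2F (q : ℂ) : F := L1F q * x2 + x2 * L1F q

/-- the quantum Serre relator `[x₁,[x₁,[x₁,x₂]]]` (braided brackets w.r.t. the bicharacter
`χ((a,b),(c,d)) = (-1)^(bd) q^(ac-ad-bc+bd)`). -/
def serre1 (q : ℂ) : F := x1 * X2F q - q • (X2F q * x1)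

/-- the quantum Serre relator `[[[x₁,x₂],x₂],x₂]` (braided brackets). -/
def serre2 (q : ℂ) : F := Y2F q * x2 - q • (x2 * Y2F q)

inductive Rel (q : ℂ) : F → F → Prop
  | one : Rel q (serre1 q) 0
  | two : Rel q (serre2 q) 0

/-- `U = U_q(A(0,2)^{(4)})^+`, the free algebra on `x₁, x₂` modulo the two-sided ideal
generated by the quantum Serre relators. -/
abbrev U (q : ℂ) : Type := RingQuot (Rel q)

def π (q : ℂ) : F →ₐ[ℂ] U q := RingQuot.mkAlgHom ℂ (Rel q)

/-- `L₁ = [X₁,Y₁] = x₁x₂ - q⁻¹ x₂x₁` in `U`. -/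
def L1U (q : ℂ) : U q := π q x1 * π q x2 - q⁻¹ • (π q x2 * π q x1)

/-- real root vectors `X_n`, `n ≥ 1` (`X 0 := 0` is junk):
`X₁ = x₁`, `X_{n+1} = [X_n, L₁] = X_n L₁ - (-1)^(n-1) L₁ X_n`
(the braiding scalar is `χ((n,n-1),(1,1)) = (-1)^(n-1)`). -/
def X (q : ℂ) : ℕ → U q
  | 0 => 0
  | 1 => π q x1
  | (n+2) => X q (n+1) * L1U q - ((-1 : ℂ)^n) • (L1U q * X q (n+1))

/-- real root vectors `Y_n`, `n ≥ 1` (`Y 0 := 0` is junk):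
`Y₁ = x₂`, `Y_{n+1} = [L₁, Y_n] = L₁ Y_n - (-1)^n Y_n L₁`
(the braiding scalar is `χ((1,1),(n-1,n)) = (-1)^n`). -/
def Y (q : ℂ) : ℕ → U q
  | 0 => 0
  | 1 => π q x2
  | (n+2) => L1U q * Y q (n+1) - ((-1 : ℂ)^(n+1)) • (Y q (n+1) * L1U q)

/-- `L₀ = θ⁻¹·1`, and `L_n = [X₁, Y_n] = X₁Y_n - q⁻¹ Y_n X₁` for `n ≥ 1`
(the braiding scalar is `χ((1,0),(n-1,n)) = q⁻¹`). -/
def L (q : ℂ) : ℕ → U q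
  | 0 => (θ q)⁻¹ • 1
  | (n+1) => X q 1 * Y q (n+1) - q⁻¹ • (Y q (n+1) * X q 1)

/-- `L₀′ = θ⁻¹·1`, `L₁′ = L₁`, and
`L_n′ = [X₂, Y_{n-1}] = X₂Y_{n-1} - (-1)^(n-1) q⁻¹ Y_{n-1}X₂` for `n ≥ 2`
(the braiding scalar is `χ((2,1),(n-2,n-1)) = (-1)^(n-1) q⁻¹`). -/
def L' (q : ℂ) : ℕ → U q
  | 0 => (θ q)⁻¹ • 1
  | 1 => L q 1
  | (n+2) => X q 2 * Y q (n+1) - ((-1 : ℂ)^(n+1) * q⁻¹) • (Y q (n+1) * X q 2)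

/-- `M q n` is the element `M_{2n+1}`:  `M₁ = L₁`, `M_{2n+1} = [L₂, M_{2n-1}]`
(a plain commutator, the braiding scalar being `1`). -/
def M (q : ℂ) : ℕ → U q
  | 0 => L q 1
  | (n+1) => L q 2 * M q n - M q n * L q 2

/-- `L̃_n = (L_n + L_n′)/2`, with the convention `L̃_n = 0` for `n < 0`
(note `L̃₀ = θ⁻¹·1`). -/
def Lt (q : ℂ) (n : ℤ) : U q :=
  if 0 ≤ n then ((2 : ℂ)⁻¹) • (L q n.toNat + L' q n.toNat) else 0

/-- `L̂_{n+1} = [L_n, L₁] = L_n L₁ - (-1)^n L₁ L_n`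
(the braiding scalar is `χ((n,n),(1,1)) = (-1)^n`); in particular `L̂₁ = 0`. -/
def Lhat (q : ℂ) : ℕ → U q
  | 0 => 0
  | (n+1) => L q n * L q 1 - ((-1 : ℂ)^n) • (L q 1 * L q n)

/-- the sequence `P₀ = 1`, `P_n = q^n + q^(n-1) + (-1)^(n-1) P_(n-1)`. -/
def P (q : ℂ) : ℕ → ℂ
  | 0 => 1
  | (n+1) => q^(n+1) + q^n + (-1 : ℂ)^n * P q n

/-- the sequence `Q₀ = 1`, `Q_n = q^n - q^(n-1) + (-1)^n Q_(n-1)`. -/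
def Q (q : ℂ) : ℕ → ℂ
  | 0 => 1
  | (n+1) => q^(n+1) - q^n + (-1 : ℂ)^(n+1) * Q q n

/-- `q` is not a root of unity. -/
def NotRootOfUnity (q : ℂ) : Prop := ∀ n : ℕ, n ≠ 0 → q ^ n ≠ 1

end QAff

open QAff

namespace QAff

section Expand

variable {A : Type*} [Ring A] [Algebra ℂ A]

/-- Distributive laws that bring a `ℂ`-linear combination of products into a sum of
scalar multiples of monomials. -/
theorem expand_rules :
    (∀ a b c : A, a * (b + c) = a * b + a * c) ∧ (∀ a b c : A, (a + b) * c = a * c + b * c) ∧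
    (∀ a b c : A, a * (b - c) = a * b - a * c) ∧ (∀ a b c : A, (a - b) * c = a * c - b * c) ∧
    (∀ a b : A, a * (-b) = -(a * b)) ∧ (∀ a b : A, (-a) * b = -(a * b)) ∧
    (∀ a b c : A, a * b * c = a * (b * c)) ∧
    (∀ (r : ℂ) (a b : A), r • (a + b) = r • a + r • b) ∧
    (∀ (r : ℂ) (a b : A), r • (a - b) = r • a - r • b) ∧
    (∀ (r : ℂ) (a : A), r • (-a) = -(r • a)) ∧
    (∀ (r t : ℂ) (a : A), r • t • a = (r * t) • a) ∧
    (∀ (r : ℂ) (a b : A), (r • a) * b = r • (a * b)) ∧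
    (∀ (r : ℂ) (a b : A), a * (r • b) = r • (a * b)) ∧
    (∀ a : A, a * 1 = a) ∧ (∀ a : A, 1 * a = a) ∧ (∀ a : A, a * 0 = 0) ∧ (∀ a : A, 0 * a = 0) ∧
    (∀ r : ℂ, r • (0 : A) = 0) := by
  refine ⟨mul_add, add_mul, mul_sub, sub_mul, mul_neg, neg_mul, mul_assoc, smul_add, smul_sub,
    smul_neg, smul_smul, smul_mul_assoc, ?_, mul_one, one_mul, mul_zero, zero_mul, smul_zero⟩
  intro r a b
  exact mul_smul_comm r a b

theorem mul_mul_of_mul_eq {a b c : A} (h : a * b = c) (t : A) : a * (b * t) = c * t := by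
  rw [← mul_assoc, h]

end Expand

/-- Real root vectors indexed by parity: `Xo i`, `Xe i`, `Yo i`, `Ye i` are `X_{2i+1}`, `X_{2i+2}`,
`Y_{2i+1}`, `Y_{2i+2}`, and `M` is the imaginary root vector `L₁`. -/
structure IsRootSystem {A : Type*} [Ring A] [Algebra ℂ A] (q : ℂ) (M : A) (Xo Xe Yo Ye : ℕ → A) :
    Prop where
  xe : ∀ i, Xe i = Xo i * M - M * Xo i
  xo : ∀ i, Xo (i + 1) = Xe i * M + M * Xe i
  ye : ∀ i, Ye i = M * Yo i + Yo i * M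
  yo : ∀ i, Yo (i + 1) = M * Ye i - Ye i * M
  m : M = Xo 0 * Yo 0 - q⁻¹ • (Yo 0 * Xo 0)
  serre_x : Xo 0 * Xe 0 = q • (Xe 0 * Xo 0)
  serre_y : Ye 0 * Yo 0 = q • (Yo 0 * Ye 0)

section Roots

variable {A : Type*} [Ring A] [Algebra ℂ A] {q : ℂ} {M : A} {Xo Xe Yo Ye : ℕ → A}

/-- The imaginary root vectors `L_{2n-1} = [X₁, Y_{2n-1}]` (zero for `n = 0`). -/
def sOdd (q : ℂ) (Xo Yo : ℕ → A) : ℕ → A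
  | 0 => 0
  | n + 1 => Xo 0 * Yo n - q⁻¹ • (Yo n * Xo 0)

/-- The imaginary root vectors `L_{2n} = [X₁, Y_{2n}]`. -/
def pEven (q : ℂ) (Xo Ye : ℕ → A) : ℕ → A
  | 0 => (θ q)⁻¹ • 1
  | n + 1 => Xo 0 * Ye n - q⁻¹ • (Ye n * Xo 0)

/-- The imaginary root vectors `L′_{2n} = [X₂, Y_{2n-1}]`. -/
def pEven' (q : ℂ) (Xe Yo : ℕ → A) : ℕ → A
  | 0 => (θ q)⁻¹ • 1
  | n + 1 => Xe 0 * Yo n + q⁻¹ • (Yo n * Xe 0)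

/-- The imaginary root vectors `L′_{2n-1} = [X₂, Y_{2n-2}]` (zero for `n = 0`). -/
def sOdd' (q : ℂ) (M : A) (Xe Ye : ℕ → A) : ℕ → A
  | 0 => 0
  | 1 => M
  | n + 2 => Xe 0 * Ye n - q⁻¹ • (Ye n * Xe 0)


/-- `[L₂, X₁]`. -/
theorem lie_xo_aux (hq : q ≠ 0) {x y z p : A} (hm : x * y = M + q⁻¹ • (y * x))
    (hz : x * M = M * x + z) (hs : x * z = q • (z * x))
    (hp : p = x * (M * y + y * M) - q⁻¹ • ((M * y + y * M) * x)) :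
    p * x - x * p = -(2 + q⁻¹) • (z * M + M * z) - (q - q⁻¹) • (z * M) := by
  rw [hp]
  simp only [expand_rules, hm, hz, hs, mul_mul_of_mul_eq hm, mul_mul_of_mul_eq hz,
    mul_mul_of_mul_eq hs]
  match_scalars <;> field_simp <;> ring

end Roots
section RootAux

variable {A : Type*} [Ring A] [Algebra ℂ A] {q : ℂ} {M : A}

/-- `[L₂, Y₁]`. -/
theorem lie_yo_aux (hq : q ≠ 0) {x y w : A} (hm : x * y = M + q⁻¹ • (y * x))
    (hs : w * y = q • (y * w)) :
    (x * w - q⁻¹ • (w * x)) * y - y * (x * w - q⁻¹ • (w * x))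
      = q • (M * w) - q⁻¹ • (w * M) := by
  simp only [expand_rules, hm, hs, mul_mul_of_mul_eq hm, mul_mul_of_mul_eq hs]
  match_scalars <;> field_simp <;> ring

/-- `[X₁, L′_{k+1}]` for either parity (`ε = ±1`) of `k`. -/
theorem lie_xo_prime_aux (hq : q ≠ 0) {x z y : A} (ε : ℂ) (hs : x * z = q • (z * x)) :
    x * (z * y - (ε * q⁻¹) • (y * z)) - (z * y - (ε * q⁻¹) • (y * z)) * x
      = q • (z * (x * y - q⁻¹ • (y * x))) - (ε * q⁻¹) • ((x * y - q⁻¹ • (y * x)) * z) := by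
  simp only [expand_rules, hs, mul_mul_of_mul_eq hs]
  match_scalars <;> field_simp

theorem m_anti_s_aux {x y : A} :
    M * (x * y - q⁻¹ • (y * x)) + (x * y - q⁻¹ • (y * x)) * M
      = (x * (M * y + y * M) - q⁻¹ • ((M * y + y * M) * x))
        - ((x * M - M * x) * y + q⁻¹ • (y * (x * M - M * x))) := by
  simp only [expand_rules]
  match_scalars <;> ring

theorem m_comm_p_aux {x y : A} :
    M * (x * y - q⁻¹ • (y * x)) - (x * y - q⁻¹ • (y * x)) * M
      = (x * (M * y - y * M) - q⁻¹ • ((M * y - y * M) * x))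
        - ((x * M - M * x) * y - q⁻¹ • (y * (x * M - M * x))) := by
  simp only [expand_rules]
  match_scalars <;> ring

theorem lie_s_aux {x z y L : A} (hz : x * M = M * x + z)
    (hx : L * x = x * L - (2 + q⁻¹) • (z * M + M * z) - (q - q⁻¹) • (z * M))
    (hy : L * y = y * L + q⁻¹ • (M * (M * y + y * M) - (M * y + y * M) * M)
      + (q - q⁻¹) • (M * (M * y + y * M))) :
    (2 : ℂ) • (x * (M * (M * y + y * M) - (M * y + y * M) * M)
        - q⁻¹ • ((M * (M * y + y * M) - (M * y + y * M) * M) * x))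
      = -(L * (x * y - q⁻¹ • (y * x)) - (x * y - q⁻¹ • (y * x)) * L)
        + (q - q⁻¹) • ((z * y + q⁻¹ • (y * z)) * M
          + M * (x * (M * y + y * M) - q⁻¹ • ((M * y + y * M) * x)))
        + (2 + q⁻¹) • (M * M * (x * y - q⁻¹ • (y * x)) - (x * y - q⁻¹ • (y * x)) * (M * M)) := by
  simp only [expand_rules, hx, mul_mul_of_mul_eq hx, hy, mul_mul_of_mul_eq hy, hz,
    mul_mul_of_mul_eq hz]
  match_scalars <;> ring

theorem lie_p_aux {x z w L : A} (hz : x * M = M * x + z)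
    (hx : L * x = x * L - (2 + q⁻¹) • (z * M + M * z) - (q - q⁻¹) • (z * M))
    (hw : L * w = w * L + (2 + q⁻¹) • (M * (M * w - w * M) + (M * w - w * M) * M)
      + (q - q⁻¹) • (M * (M * w - w * M))) :
    L * (x * w - q⁻¹ • (w * x)) - (x * w - q⁻¹ • (w * x)) * L
      = (2 + q⁻¹) • (M * M * (x * w - q⁻¹ • (w * x)) - (x * w - q⁻¹ • (w * x)) * (M * M))
        + (q - q⁻¹) • (M * (x * (M * w - w * M) - q⁻¹ • ((M * w - w * M) * x))
          - (z * w - q⁻¹ • (w * z)) * M) := by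
  simp only [expand_rules, hx, mul_mul_of_mul_eq hx, hw, mul_mul_of_mul_eq hw, hz,
    mul_mul_of_mul_eq hz]
  match_scalars <;> ring

theorem lie_xe_aux (hq : q ≠ 0) (hq3 : 1 + q + q⁻¹ ≠ 0) {x z u L s : A} (hz : x * M = M * x + z)
    (hu : u = z * M + M * z)
    (hx : L * x = x * L - (2 + q⁻¹) • u - (q - q⁻¹) • (z * M))
    (hs : (2 : ℂ) • s = (L * M - M * L) + (q - q⁻¹) • (L * M + M * L - (2 : ℂ) • (M * (M * M))))
    (hc : x * s - s * x = q • (z * L) - q⁻¹ • (L * z)) :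
    L * z = z * L - q⁻¹ • (u * M - M * u) - (q - q⁻¹) • (u * M) := by
  have hx' : x * L = L * x + (2 + q⁻¹) • u + (q - q⁻¹) • (z * M) := by rw [hx]; abel
  have h2 : x * ((2 : ℂ) • s) - ((2 : ℂ) • s) * x
      = (2 : ℂ) • (q • (z * L) - q⁻¹ • (L * z)) := by
    rw [← hc, mul_smul_comm, smul_mul_assoc, smul_sub]
  have hu' : z * M = u - M * z := by rw [hu]; abel
  have key : (1 + q + q⁻¹) • (L * z - (z * L - q⁻¹ • (u * M - M * u) - (q - q⁻¹) • (u * M))) = 0 := by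
    rw [← sub_eq_zero] at h2
    rw [← h2, hs]
    simp only [expand_rules, hx', mul_mul_of_mul_eq hx', hz, mul_mul_of_mul_eq hz, hu',
      mul_mul_of_mul_eq hu']
    match_scalars <;> field_simp <;> ring
  rcases smul_eq_zero.1 key with h | h
  · exact absurd h hq3
  · exact sub_eq_zero.1 h

theorem lie_ye_aux (hq : q ≠ 0) (hq6 : 1 - q - q⁻¹ ≠ 0) {y w v L s : A} (hw : y * M = w - M * y)
    (hv : v = M * w - w * M)
    (hy : L * y = y * L + q⁻¹ • v + (q - q⁻¹) • (M * w))
    (hs : (2 : ℂ) • s = (L * M - M * L) + (q - q⁻¹) • (L * M + M * L - (2 : ℂ) • (M * (M * M))))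
    (hc : s * y + y * s = q • ((L - (2 : ℂ) • (M * M)) * w) - q⁻¹ • (w * (L - (2 : ℂ) • (M * M)))) :
    L * w = w * L + (2 + q⁻¹) • (M * v + v * M) + (q - q⁻¹) • (M * v) := by
  have hy' : y * L = L * y - q⁻¹ • v - (q - q⁻¹) • (M * w) := by rw [hy]; abel
  have h2 : ((2 : ℂ) • s) * y + y * ((2 : ℂ) • s)
      = (2 : ℂ) • (q • ((L - (2 : ℂ) • (M * M)) * w) - q⁻¹ • (w * (L - (2 : ℂ) • (M * M)))) := by
    rw [← hc, mul_smul_comm, smul_mul_assoc, smul_add]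
  have hv' : w * M = M * w - v := by rw [hv]; abel
  have key : (1 - q - q⁻¹) •
      (L * w - (w * L + (2 + q⁻¹) • (M * v + v * M) + (q - q⁻¹) • (M * v))) = 0 := by
    rw [← sub_eq_zero] at h2
    rw [← h2, hs]
    simp only [expand_rules, hy', mul_mul_of_mul_eq hy', hw, mul_mul_of_mul_eq hw, hv',
      mul_mul_of_mul_eq hv']
    match_scalars <;> field_simp <;> ring
  rcases smul_eq_zero.1 key with h | h
  · exact absurd h hq6
  · exact sub_eq_zero.1 h

end RootAux
section CurrentAux

variable {A : Type*} [Ring A] [Algebra ℂ A] {q : ℂ} {M : A}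

theorem lie_s_prime_aux {z u w L : A} (hz : z * M = u - M * z)
    (hx : L * z = z * L - q⁻¹ • (u * M - M * u) - (q - q⁻¹) • (u * M))
    (hw : L * w = w * L + (2 + q⁻¹) • (M * (M * w - w * M) + (M * w - w * M) * M)
      + (q - q⁻¹) • (M * (M * w - w * M))) :
    (2 : ℂ) • (z * (M * (M * w - w * M) + (M * w - w * M) * M)
        - q⁻¹ • ((M * (M * w - w * M) + (M * w - w * M) * M) * z))
      = (L * (z * w - q⁻¹ • (w * z)) - (z * w - q⁻¹ • (w * z)) * L)
        - q⁻¹ • (M * M * (z * w - q⁻¹ • (w * z)) - (z * w - q⁻¹ • (w * z)) * (M * M))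
        + (q - q⁻¹) • ((u * w - q⁻¹ • (w * u)) * M
          + M * (z * (M * w - w * M) + q⁻¹ • ((M * w - w * M) * z))) := by
  simp only [expand_rules, hx, mul_mul_of_mul_eq hx, hw, mul_mul_of_mul_eq hw, hz,
    mul_mul_of_mul_eq hz]
  match_scalars <;> ring

theorem lie_p_prime_aux {z u y L : A} (hz : z * M = u - M * z)
    (hx : L * z = z * L - q⁻¹ • (u * M - M * u) - (q - q⁻¹) • (u * M))
    (hy : L * y = y * L + q⁻¹ • (M * (M * y + y * M) - (M * y + y * M) * M)
      + (q - q⁻¹) • (M * (M * y + y * M))) :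
    L * (z * y + q⁻¹ • (y * z)) - (z * y + q⁻¹ • (y * z)) * L
      = q⁻¹ • (M * M * (z * y + q⁻¹ • (y * z)) - (z * y + q⁻¹ • (y * z)) * (M * M))
        + (q - q⁻¹) • ((u * y - q⁻¹ • (y * u)) * M
          - M * (z * (M * y + y * M) - q⁻¹ • ((M * y + y * M) * z))) := by
  simp only [expand_rules, hx, mul_mul_of_mul_eq hx, hy, mul_mul_of_mul_eq hy, hz,
    mul_mul_of_mul_eq hz]
  match_scalars <;> ring

/-- A bracket formula for `ad L` is stable under `ad (M * M)` if `L` commutes with `M * M`. -/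
theorem lie_shift_aux {y L : A} (hL : L * (M * M) = M * M * L) (r t : ℂ) {d e : A}
    (hy : L * y = y * L + r • d + t • e) :
    L * (M * M * y - y * (M * M)) = (M * M * y - y * (M * M)) * L
      + r • (M * M * d - d * (M * M)) + t • (M * M * e - e * (M * M)) := by
  calc _ = (L * (M * M)) * y - (L * y) * (M * M) := by noncomm_ring
    _ = M * M * (L * y) - (L * y) * (M * M) := by rw [hL]; noncomm_ring
    _ = M * M * y * L - y * (L * (M * M)) + r • (M * M * d - d * (M * M))
        + t • (M * M * e - e * (M * M)) := by
      rw [hy]; simp only [expand_rules]; match_scalars <;> ring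
    _ = _ := by rw [hL]; simp only [expand_rules]

end CurrentAux

namespace IsRootSystem

variable {A : Type*} [Ring A] [Algebra ℂ A] {q : ℂ} {M : A} {Xo Xe Yo Ye : ℕ → A}

theorem xo_succ (h : IsRootSystem q M Xo Xe Yo Ye) (i : ℕ) :
    Xo (i + 1) = Xo i * (M * M) - M * M * Xo i := by
  rw [h.xo, h.xe]; noncomm_ring

theorem xe_succ (h : IsRootSystem q M Xo Xe Yo Ye) (i : ℕ) :
    Xe (i + 1) = Xe i * (M * M) - M * M * Xe i := by
  rw [h.xe, h.xo]; noncomm_ring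

theorem yo_succ (h : IsRootSystem q M Xo Xe Yo Ye) (i : ℕ) :
    Yo (i + 1) = M * M * Yo i - Yo i * (M * M) := by
  rw [h.yo, h.ye]; noncomm_ring

theorem ye_succ (h : IsRootSystem q M Xo Xe Yo Ye) (i : ℕ) :
    Ye (i + 1) = M * M * Ye i - Ye i * (M * M) := by
  rw [h.ye, h.yo]; noncomm_ring

theorem m_anti_s (h : IsRootSystem q M Xo Xe Yo Ye) (n : ℕ) :
    M * sOdd q Xo Yo n + sOdd q Xo Yo n * M = pEven q Xo Ye n - pEven' q Xe Yo n := by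
  cases n with
  | zero => simp [sOdd, pEven, pEven']
  | succ n => simp only [sOdd, pEven, pEven', h.ye, h.xe]; exact m_anti_s_aux

theorem m_comm_p (h : IsRootSystem q M Xo Xe Yo Ye) (n : ℕ) :
    M * pEven q Xo Ye n - pEven q Xo Ye n * M
      = sOdd q Xo Yo (n + 1) - sOdd' q M Xe Ye (n + 1) := by
  cases n with
  | zero => simp only [sOdd, pEven, sOdd', ← h.m]; simp
  | succ n => simp only [sOdd, pEven, sOdd', h.yo, h.xe]; exact m_comm_p_aux

theorem p_one_sub (h : IsRootSystem q M Xo Xe Yo Ye) :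
    pEven' q Xe Yo 1 = pEven q Xo Ye 1 - (2 : ℂ) • (M * M) := by
  have := h.m_anti_s 1
  simp only [sOdd] at this
  rw [← h.m] at this
  rw [two_smul, this]; abel

theorem lie_xo (h : IsRootSystem q M Xo Xe Yo Ye) (hq : q ≠ 0) :
    pEven q Xo Ye 1 * Xo 0 = Xo 0 * pEven q Xo Ye 1 - (2 + q⁻¹) • Xo 1
      - (q - q⁻¹) • (Xe 0 * M) := by
  have h1 : Xo 0 * Yo 0 = M + q⁻¹ • (Yo 0 * Xo 0) := by
    conv_rhs => enter [1]; rw [h.m]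
    abel
  have h2 : Xo 0 * M = M * Xo 0 + Xe 0 := by rw [h.xe]; abel
  have := lie_xo_aux hq h1 h2 h.serre_x (p := pEven q Xo Ye 1) (by simp [pEven, h.ye])
  rw [sub_eq_iff_eq_add] at this
  rw [this, h.xo, neg_smul]; abel

theorem lie_yo_zero (h : IsRootSystem q M Xo Xe Yo Ye) (hq : q ≠ 0) :
    pEven q Xo Ye 1 * Yo 0 = Yo 0 * pEven q Xo Ye 1 + q⁻¹ • Yo 1 + (q - q⁻¹) • (M * Ye 0) := by
  have h1 : Xo 0 * Yo 0 = M + q⁻¹ • (Yo 0 * Xo 0) := by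
    conv_rhs => enter [1]; rw [h.m]
    abel
  have := lie_yo_aux hq h1 h.serre_y
  rw [sub_eq_iff_eq_add] at this
  simp only [pEven]
  rw [this, h.yo]; module

theorem two_smul_s_two (h : IsRootSystem q M Xo Xe Yo Ye) (hq : q ≠ 0) :
    (2 : ℂ) • sOdd q Xo Yo 2
      = -(pEven q Xo Ye 1 * M - M * pEven q Xo Ye 1)
        + (q - q⁻¹) • (pEven' q Xe Yo 1 * M + M * pEven q Xo Ye 1) := by
  have h1 := h.lie_xo hq
  rw [h.xo] at h1
  have h2 := h.lie_yo_zero hq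
  rw [h.yo, h.ye] at h2
  have h3 : Xo 0 * M = M * Xo 0 + Xe 0 := by rw [h.xe]; abel
  have := lie_s_aux h3 h1 h2
  rw [← h.m] at this
  simp only [sOdd, pEven, pEven', h.yo, h.ye]
  rw [this]
  simp only [pEven, h.ye, mul_assoc, sub_self, smul_zero, add_zero]

theorem two_smul_s_prime_two (h : IsRootSystem q M Xo Xe Yo Ye) (hq : q ≠ 0) :
    (2 : ℂ) • sOdd' q M Xe Ye 2
      = (pEven q Xo Ye 1 * M - M * pEven q Xo Ye 1)
        + (q - q⁻¹) • (pEven q Xo Ye 1 * M + M * pEven q Xo Ye 1 - (2 : ℂ) • (M * (M * M))) := by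
  have h1 := h.two_smul_s_two hq
  have h2 := h.m_comm_p 1
  have h3 : sOdd' q M Xe Ye 2 = sOdd q Xo Yo 2
      - (M * pEven q Xo Ye 1 - pEven q Xo Ye 1 * M) := by rw [h2]; abel
  rw [h3, smul_sub, h1, h.p_one_sub]
  simp only [expand_rules]
  match_scalars <;> ring

theorem lie_xe (h : IsRootSystem q M Xo Xe Yo Ye) (hq : q ≠ 0) (hq3 : 1 + q + q⁻¹ ≠ 0) :
    pEven q Xo Ye 1 * Xe 0 = Xe 0 * pEven q Xo Ye 1 - q⁻¹ • (Xo 1 * M - M * Xo 1)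
      - (q - q⁻¹) • (Xo 1 * M) := by
  refine lie_xe_aux hq hq3 (x := Xo 0) (s := sOdd' q M Xe Ye 2) ?_ (h.xo 0) (h.lie_xo hq)
    (h.two_smul_s_prime_two hq) ?_
  · rw [h.xe]; abel
  · have := lie_xo_prime_aux (y := Ye 0) hq 1 h.serre_x
    simpa [sOdd', pEven] using this

theorem lie_ye_zero (h : IsRootSystem q M Xo Xe Yo Ye) (hq : q ≠ 0) (hq6 : 1 - q - q⁻¹ ≠ 0) :
    pEven q Xo Ye 1 * Ye 0 = Ye 0 * pEven q Xo Ye 1 + (2 + q⁻¹) • Ye 1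
      + (q - q⁻¹) • (M * Yo 1) := by
  rw [h.ye 1]
  refine lie_ye_aux hq hq6 (y := Yo 0) (s := sOdd' q M Xe Ye 2) ?_ (h.yo 0) (h.lie_yo_zero hq)
    (h.two_smul_s_prime_two hq) ?_
  · rw [h.ye]; abel
  · rw [← h.p_one_sub]
    simp only [sOdd', pEven']
    have hs := h.serre_y
    simp only [expand_rules, hs, mul_mul_of_mul_eq hs]
    match_scalars <;> field_simp

theorem lie_m_sq (h : IsRootSystem q M Xo Xe Yo Ye) (hq : q ≠ 0) (hq3 : 1 + q + q⁻¹ ≠ 0)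
    (hq6 : 1 - q - q⁻¹ ≠ 0) (hq4 : q + q⁻¹ ≠ 0) :
    pEven q Xo Ye 1 * (M * M) = M * M * pEven q Xo Ye 1 := by
  have a1 := h.lie_xo hq
  rw [h.xo] at a1
  have a2 := h.lie_ye_zero hq hq6
  rw [h.ye 1, h.yo] at a2
  have a3 : Xo 0 * M = M * Xo 0 + Xe 0 := by rw [h.xe]; abel
  have hp := lie_p_aux a3 a1 a2
  have b1 := h.lie_xe hq hq3
  have b2 := h.lie_yo_zero hq
  rw [h.yo, h.ye] at b2
  have b3 : Xe 0 * M = Xo 1 - M * Xe 0 := by rw [h.xo]; abel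
  have hp' := lie_p_prime_aux b3 b1 b2
  have e1 : Xo 0 * Ye 0 - q⁻¹ • (Ye 0 * Xo 0) = pEven q Xo Ye 1 := rfl
  have e2 : Xe 0 * Yo 0 + q⁻¹ • (Yo 0 * Xe 0) = pEven q Xo Ye 1 - (2 : ℂ) • (M * M) :=
    h.p_one_sub
  have e3 : Xo 1 * Yo 0 - q⁻¹ • (Yo 0 * Xo 1) = sOdd q Xo Yo 2 := by
    have : (Xo 0 * Yo 0 - q⁻¹ • (Yo 0 * Xo 0)) * (M * M)
      - M * M * (Xo 0 * Yo 0 - q⁻¹ • (Yo 0 * Xo 0)) = 0 := by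
      rw [← h.m]; noncomm_ring
    rw [← sub_eq_zero, ← this]
    simp only [sOdd]
    rw [h.xo_succ, h.yo_succ]
    simp only [expand_rules]
    match_scalars <;> ring
  rw [← h.yo, e1] at hp
  rw [e2, ← h.ye, e3] at hp'
  have e4 : Xo 0 * Yo 1 - q⁻¹ • (Yo 1 * Xo 0) = sOdd q Xo Yo 2 := rfl
  have e5 : Xe 0 * Ye 0 - q⁻¹ • (Ye 0 * Xe 0) = sOdd q Xo Yo 2
      - (M * pEven q Xo Ye 1 - pEven q Xo Ye 1 * M) := by
    rw [h.m_comm_p 1]; simp [sOdd']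
  rw [e4, e5] at hp
  rw [e5] at hp'
  generalize pEven q Xo Ye 1 = L at *
  generalize sOdd q Xo Yo 2 = s at *
  have key : (q + q⁻¹) • (L * (M * M) - M * M * L) = 0 := by
    rw [← sub_eq_zero] at hp hp'
    have := congrArg₂ (· + ·) hp hp'
    simp only [add_zero] at this
    rw [← this]
    simp only [expand_rules]
    match_scalars <;> ring
  exact sub_eq_zero.1 ((smul_eq_zero.1 key).resolve_left hq4)

end IsRootSystem
/-- The relations between the imaginary root vectors `s n = L_{2n-1}`, `p n = L_{2n}`,
`s' n = L′_{2n-1}`, `p' n = L′_{2n}` that follow from the action of `L₂` on real root vectors. -/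
structure IsCurrentSystem {A : Type*} [Ring A] [Algebra ℂ A] (q : ℂ) (M : A) (s p s' p' : ℕ → A) :
    Prop where
  s_zero : s 0 = 0
  s'_zero : s' 0 = 0
  p_zero : p 0 = (θ q)⁻¹ • 1
  p'_zero : p' 0 = (θ q)⁻¹ • 1
  s_one : s 1 = M
  m_anti_s : ∀ n, M * s n + s n * M = p n - p' n
  m_comm_p : ∀ n, M * p n - p n * M = s (n + 1) - s' (n + 1)
  lie_sq : p 1 * (M * M) = M * M * p 1
  s_succ : ∀ n, (2 : ℂ) • s (n + 1) = -(p 1 * s n - s n * p 1)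
    + (q - q⁻¹) • (p' n * M + M * p n) + (2 + q⁻¹) • (M * M * s n - s n * (M * M))
  s'_succ : ∀ n, (2 : ℂ) • s' (n + 2) = (p 1 * s' (n + 1) - s' (n + 1) * p 1)
    - q⁻¹ • (M * M * s' (n + 1) - s' (n + 1) * (M * M))
    + (q - q⁻¹) • ((p (n + 1) - (M * M * p n - p n * (M * M))) * M + M * p' (n + 1))
  lie_p : ∀ n, p 1 * p n - p n * p 1 = (2 + q⁻¹) • (M * M * p n - p n * (M * M))
    + (q - q⁻¹) • (M * s (n + 1) - s' (n + 1) * M)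
  lie_p' : ∀ n, p 1 * p' n - p' n * p 1 = q⁻¹ • (M * M * p' n - p' n * (M * M))
    + (q - q⁻¹) • ((s (n + 1) - (M * M * s n - s n * (M * M))) * M - M * s' (n + 1))

namespace IsRootSystem

variable {A : Type*} [Ring A] [Algebra ℂ A] {q : ℂ} {M : A} {Xo Xe Yo Ye : ℕ → A}

theorem lie_yo (h : IsRootSystem q M Xo Xe Yo Ye) (hq : q ≠ 0)
    (hL : pEven q Xo Ye 1 * (M * M) = M * M * pEven q Xo Ye 1) (i : ℕ) :
    pEven q Xo Ye 1 * Yo i = Yo i * pEven q Xo Ye 1 + q⁻¹ • Yo (i + 1)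
      + (q - q⁻¹) • (M * Ye i) := by
  induction i with
  | zero => exact h.lie_yo_zero hq
  | succ i ih =>
    have := lie_shift_aux hL _ _ ih
    rw [← h.yo_succ, ← h.yo_succ] at this
    rw [this, h.ye_succ]
    simp only [mul_sub, mul_assoc]

theorem lie_ye (h : IsRootSystem q M Xo Xe Yo Ye) (hq : q ≠ 0) (hq6 : 1 - q - q⁻¹ ≠ 0)
    (hL : pEven q Xo Ye 1 * (M * M) = M * M * pEven q Xo Ye 1) (i : ℕ) :
    pEven q Xo Ye 1 * Ye i = Ye i * pEven q Xo Ye 1 + (2 + q⁻¹) • Ye (i + 1)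
      + (q - q⁻¹) • (M * Yo (i + 1)) := by
  induction i with
  | zero => exact h.lie_ye_zero hq hq6
  | succ i ih =>
    have := lie_shift_aux hL _ _ ih
    rw [← h.ye_succ, ← h.ye_succ] at this
    rw [this, h.yo_succ (i + 1)]
    simp only [mul_sub, mul_assoc]

theorem isCurrentSystem (h : IsRootSystem q M Xo Xe Yo Ye) (hq : q ≠ 0) (hq3 : 1 + q + q⁻¹ ≠ 0)
    (hq6 : 1 - q - q⁻¹ ≠ 0) (hq4 : q + q⁻¹ ≠ 0) (hθ : θ q ≠ 0) :
    IsCurrentSystem q M (sOdd q Xo Yo) (pEven q Xo Ye) (sOdd' q M Xe Ye) (pEven' q Xe Yo) := by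
  have hL := h.lie_m_sq hq hq3 hq6 hq4
  have hx := h.lie_xo hq
  rw [h.xo] at hx
  have hx3 : Xo 0 * M = M * Xo 0 + Xe 0 := by rw [h.xe]; abel
  have hz := h.lie_xe hq hq3
  have hz3 : Xe 0 * M = Xo 1 - M * Xe 0 := by rw [h.xo]; abel
  have hy : ∀ i, _ := fun i => h.lie_yo hq hL i
  have hw : ∀ i, _ := fun i => h.lie_ye hq hq6 hL i
  have hu : ∀ y : A, Xo 1 * y - q⁻¹ • (y * Xo 1)
      = (Xo 0 * (M * M * y - y * (M * M)) - q⁻¹ • ((M * M * y - y * (M * M)) * Xo 0))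
        - (M * M * (Xo 0 * y - q⁻¹ • (y * Xo 0)) - (Xo 0 * y - q⁻¹ • (y * Xo 0)) * (M * M)) := by
    intro y
    rw [h.xo_succ]
    simp only [expand_rules]
    match_scalars <;> ring
  refine ⟨rfl, rfl, rfl, rfl, h.m.symm, h.m_anti_s, h.m_comm_p, hL, ?_, ?_, ?_, ?_⟩
  · rintro (_ | i)
    · rw [show q - q⁻¹ = θ q from rfl]
      simp only [sOdd, pEven, pEven', ← h.m, expand_rules]
      match_scalars <;> field_simp <;> ring
    · have := hy i
      rw [h.yo, h.ye] at this
      have := lie_s_aux hx3 hx this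
      rw [← h.ye, ← h.yo] at this
      exact this
  · rintro (_ | i)
    · rw [show sOdd' q M Xe Ye (0 + 1) = M from rfl, h.two_smul_s_prime_two hq, h.p_one_sub]
      simp only [pEven, expand_rules]
      match_scalars <;> ring
    · have := hw i
      rw [h.ye (i + 1), h.yo] at this
      have := lie_s_prime_aux hz3 hz this
      rw [← h.yo, ← h.ye, hu, ← h.ye_succ] at this
      exact this
  · rintro (_ | i)
    · rw [show q - q⁻¹ = θ q from rfl]
      simp only [sOdd, pEven, sOdd', ← h.m, expand_rules]
      match_scalars <;> field_simp <;> ring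
    · have := hw i
      rw [h.ye (i + 1), h.yo] at this
      have := lie_p_aux hx3 hx this
      rw [← h.yo] at this
      exact this
  · rintro (_ | i)
    · rw [show q - q⁻¹ = θ q from rfl]
      simp only [sOdd, pEven', sOdd', ← h.m, expand_rules]
      match_scalars <;> field_simp <;> ring
    · have := hy i
      rw [h.yo, h.ye] at this
      have := lie_p_prime_aux hz3 hz this
      rw [← h.ye, hu, ← h.yo_succ] at this
      exact this

end IsRootSystem
section Chain

variable {A : Type*} [Ring A] [Algebra ℂ A] {q : ℂ}

theorem lie_sq_recursion {t : ℂ} {e₀ e₁ e₂ e₃ e₄ N₀ N₁ N₂ : A}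
    (h4 : e₄ * N₀ = N₀ * e₄ + (t / 2) • (e₃ * N₁ + N₁ * e₃) + (1 / 4 : ℂ) • (e₂ * N₂ - N₂ * e₂))
    (h3 : e₃ * N₀ = N₀ * e₃ + (t / 2) • (e₂ * N₁ + N₁ * e₂) + (1 / 4 : ℂ) • (e₁ * N₂ - N₂ * e₁))
    (h2 : e₂ * N₀ = N₀ * e₂ + (t / 2) • (e₁ * N₁ + N₁ * e₁) + (1 / 4 : ℂ) • (e₀ * N₂ - N₂ * e₀))
    (y1 : N₁ * N₀ = -(N₀ * N₁)) (y2 : N₂ * N₀ = -(N₀ * N₂) - (2 : ℂ) • (N₁ * N₁)) :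
    e₄ * (N₀ * N₀) - N₀ * N₀ * e₄
      = -((t ^ 2 + 2) / 4) • (e₂ * (N₁ * N₁) - N₁ * N₁ * e₂)
        - (t / 8) • (e₁ * (N₁ * N₂ + N₂ * N₁) + (N₁ * N₂ + N₂ * N₁) * e₁)
        - (1 / 16 : ℂ) • (e₀ * (N₂ * N₂) - N₂ * N₂ * e₀) := by
  simp only [expand_rules, h4, h3, h2, y1, y2, mul_mul_of_mul_eq h4, mul_mul_of_mul_eq h3,
    mul_mul_of_mul_eq h2, mul_mul_of_mul_eq y1, mul_mul_of_mul_eq y2]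
  match_scalars <;> ring

/-- A truncated family of operators `a m` acting on `N k` by a three-term rule. The rule is known
for `m < n`, and for `(m, k) = (n, 0)`. -/
structure IsTower (q : ℂ) (n : ℕ) (a : ℤ → A) (D : A) (N : ℕ → A) : Prop where
  zero : a 0 = (θ q)⁻¹ • 1
  neg : ∀ m < 0, a m = 0
  succ : ∀ k, N (k + 1) = D * N k - N k * D
  rule : ∀ (m : ℤ) (k : ℕ), m < n ∨ m = n ∧ k = 0 → a m * N k = N k * a m
    + (θ q / 2) • (a (m - 1) * N (k + 1) + N (k + 1) * a (m - 1))
    + (1 / 4 : ℂ) • (a (m - 2) * N (k + 2) - N (k + 2) * a (m - 2))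
  anti : ∀ k, 2 * k + 1 < n → N k * N (k + 1) + N (k + 1) * N k = 0

namespace IsTower

variable {n : ℕ} {a : ℤ → A} {D : A} {N : ℕ → A}

theorem recursion (h : IsTower q n a D N) (m : ℤ) (k : ℕ) (hmk : m < n ∨ m = n ∧ k = 0)
    (hk : N k * N (k + 1) + N (k + 1) * N k = 0) :
    a m * (N k * N k) - N k * N k * a m
      = -((θ q ^ 2 + 2) / 4) • (a (m - 2) * (N (k + 1) * N (k + 1)) - N (k + 1) * N (k + 1) * a (m - 2))
        - (θ q / 8) • (a (m - 3) * (N (k + 1) * N (k + 2) + N (k + 2) * N (k + 1))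
          + (N (k + 1) * N (k + 2) + N (k + 2) * N (k + 1)) * a (m - 3))
        - (1 / 16 : ℂ) •
          (a (m - 4) * (N (k + 2) * N (k + 2)) - N (k + 2) * N (k + 2) * a (m - 4)) := by
  have h3 := h.rule (m - 1) k (by omega)
  have h2 := h.rule (m - 2) k (by omega)
  have y1 : N (k + 1) * N k = -(N k * N (k + 1)) := by
    rw [eq_neg_iff_add_eq_zero, add_comm]; exact hk
  rw [show m - 1 - 1 = m - 2 by ring, show m - 1 - 2 = m - 3 by ring] at h3
  rw [show m - 2 - 1 = m - 3 by ring, show m - 2 - 2 = m - 4 by ring] at h2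
  refine lie_sq_recursion (h.rule m k hmk) h3 h2 y1 ?_
  · have e : D * (N k * N (k + 1) + N (k + 1) * N k) - (N k * N (k + 1) + N (k + 1) * N k) * D
        = 0 := by rw [hk]; simp
    have e1 : D * N k = N k * D + N (k + 1) := by rw [h.succ]; abel
    have e2 : D * N (k + 1) = N (k + 1) * D + N (k + 2) := by rw [h.succ (k + 1)]; abel
    rw [← sub_eq_zero, ← e]
    simp only [expand_rules, e1, e2, mul_mul_of_mul_eq e1, mul_mul_of_mul_eq e2]
    match_scalars <;> ring

theorem lie_sq_even (h : IsTower q n a D N) (l : ℕ) :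
    ∀ k : ℕ, 2 * l + 2 * k ≤ n →
      a (2 * l : ℕ) * (N k * N k) - N k * N k * a (2 * l : ℕ) = 0 := by
  induction l using Nat.strong_induction_on with
  | _ l ih =>
    intro k hk
    rcases l with _ | _ | l
    · simp [h.zero]
    · rw [h.recursion _ _ (by omega) (h.anti k (by omega)),
        h.neg (((2 * (0 + 1) : ℕ) : ℤ) - 3) (by omega), h.neg (((2 * (0 + 1) : ℕ) : ℤ) - 4) (by omega),
        show ((2 * (0 + 1) : ℕ) : ℤ) - 2 = 0 by norm_num, h.zero]
      simp
    · rw [h.recursion _ _ (by omega) (h.anti k (by omega)), h.anti (k + 1) (by omega),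
        show ((2 * (l + 1 + 1) : ℕ) : ℤ) - 2 = (2 * (l + 1) : ℕ) by push_cast; ring,
        show ((2 * (l + 1 + 1) : ℕ) : ℤ) - 4 = (2 * l : ℕ) by push_cast; ring,
        ih (l + 1) (by omega) (k + 1) (by omega), ih l (by omega) (k + 2) (by omega)]
      simp

theorem lie_sq_odd (h : IsTower q n a D N) (hq : q ≠ 0) (hθ : θ q ≠ 0) (k : ℕ) (hk : 2 * k ≤ n)
    (l : ℕ) :
    ∀ i : ℕ, i + l = k → (2 * l + 1 < n ∨ 2 * l + 1 = n ∧ i = 0) →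
      ((-4) ^ l * θ q) •
          (a (2 * l + 1 : ℕ) * (N i * N i) - N i * N i * a (2 * l + 1 : ℕ))
        = (q ^ (2 * l + 1) - q⁻¹ ^ (2 * l + 1)) • (N k * N (k + 1) + N (k + 1) * N k) := by
  have h1 : ∀ i, (1 < n ∨ 1 = n ∧ i = 0) →
      a 1 * (N i * N i) - N i * N i * a 1 = N i * N (i + 1) + N (i + 1) * N i := by
    intro i hi
    have e : a 1 * N i = N i * a 1 + N (i + 1) := by
      rw [h.rule 1 i (by omega), h.neg (1 - 2) (by omega), show (1 : ℤ) - 1 = 0 by norm_num, h.zero]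
      simp only [expand_rules]
      match_scalars <;> field_simp <;> ring
    simp only [expand_rules, e, mul_mul_of_mul_eq e]
    abel
  induction l using Nat.strong_induction_on with
  | _ l ih =>
    intro i hi hl
    rcases l with _ | _ | l
    · obtain rfl : i = k := by omega
      simp only [mul_zero, zero_add, pow_zero, one_mul, pow_one, Nat.cast_one]
      rw [h1 i (by omega)]
      rfl
    · obtain rfl : k = i + 1 := by omega
      rw [h.recursion _ _ (by omega) (h.anti i (by omega)),
        show ((2 * (0 + 1) + 1 : ℕ) : ℤ) - 2 = 1 by norm_num,
        show ((2 * (0 + 1) + 1 : ℕ) : ℤ) - 3 = 0 by norm_num,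
        h.neg (((2 * (0 + 1) + 1 : ℕ) : ℤ) - 4) (by omega), h.zero, h1 _ (by omega)]
      simp only [expand_rules]
      have : q ^ (2 * (0 + 1) + 1) - q⁻¹ ^ (2 * (0 + 1) + 1) = θ q * (θ q ^ 2 + 3) := by
        have hr : q * q⁻¹ = 1 := mul_inv_cancel₀ hq
        simp only [θ]
        linear_combination (3 * q - 3 * q⁻¹) * hr
      rw [this]
      match_scalars <;> field_simp <;> ring
    · have i2 := ih (l + 1) (by omega) (i + 1) (by omega) (by omega)
      have i3 := ih l (by omega) (i + 2) (by omega) (by omega)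
      rw [h.recursion _ _ (by omega) (h.anti i (by omega)), h.anti (i + 1) (by omega),
        show ((2 * (l + 1 + 1) + 1 : ℕ) : ℤ) - 2 = (2 * (l + 1) + 1 : ℕ) by push_cast; ring,
        show ((2 * (l + 1 + 1) + 1 : ℕ) : ℤ) - 4 = (2 * l + 1 : ℕ) by push_cast; ring]
      have e : q ^ (2 * (l + 1 + 1) + 1) - q⁻¹ ^ (2 * (l + 1 + 1) + 1)
          = (θ q ^ 2 + 2) * (q ^ (2 * (l + 1) + 1) - q⁻¹ ^ (2 * (l + 1) + 1))
            - (q ^ (2 * l + 1) - q⁻¹ ^ (2 * l + 1)) := by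
        have hr : q * q⁻¹ = 1 := mul_inv_cancel₀ hq
        rw [show 2 * (l + 1 + 1) + 1 = 2 * l + 1 + 2 + 2 by ring,
          show 2 * (l + 1) + 1 = 2 * l + 1 + 2 by ring]
        generalize 2 * l + 1 = m
        simp only [θ]
        linear_combination
          (2 * q ^ (m + 2) - q ^ m * (q * q⁻¹ + 1) - 2 * q⁻¹ ^ (m + 2)
            + q⁻¹ ^ m * (q * q⁻¹ + 1)) * hr
      rw [e, sub_smul, mul_smul (θ q ^ 2 + 2), ← i2, ← i3]
      simp only [mul_zero, zero_mul, add_zero, smul_zero, sub_zero, smul_sub, smul_smul]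
      match_scalars <;> ring

end IsTower

end Chain

section Average

variable {A : Type*} [Ring A] [Algebra ℂ A]

/-- The average of two sequences, extended by zero to negative indices. -/
def average (p p' : ℕ → A) (m : ℤ) : A :=
  if 0 ≤ m then (2 : ℂ)⁻¹ • (p m.toNat + p' m.toNat) else 0

theorem average_natCast (p p' : ℕ → A) (m : ℕ) :
    average p p' m = (2 : ℂ)⁻¹ • (p m + p' m) := by
  simp [average]

theorem average_of_neg (p p' : ℕ → A) {m : ℤ} (hm : m < 0) : average p p' m = 0 := by
  simp [average, not_le.2 hm]

/-- Iterated commutators `(ad D)^k M`. -/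
def iterLie (D M : A) : ℕ → A
  | 0 => M
  | k + 1 => D * iterLie D M k - iterLie D M k * D

end Average

namespace IsCurrentSystem

variable {A : Type*} [Ring A] [Algebra ℂ A] {q : ℂ} {M : A} {s p s' p' : ℕ → A}

theorem p'_eq (h : IsCurrentSystem q M s p s' p') (n : ℕ) :
    p' n = p n - (M * s n + s n * M) := by rw [h.m_anti_s]; abel

theorem s'_succ_eq (h : IsCurrentSystem q M s p s' p') (n : ℕ) :
    s' (n + 1) = s (n + 1) - (M * p n - p n * M) := by rw [h.m_comm_p]; abel

/-- The imaginary root vectors up to level `n` commute with `M * M`. -/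
structure CommUpTo (M : A) (s p : ℕ → A) (n : ℕ) : Prop where
  comm_p : ∀ m < n, M * M * p m = p m * (M * M)
  comm_s : ∀ m ≤ n, M * M * s m = s m * (M * M)
  anti : ∀ k, 2 * k + 1 < n → iterLie (p 1) M k * iterLie (p 1) M (k + 1)
    + iterLie (p 1) M (k + 1) * iterLie (p 1) M k = 0

namespace CommUpTo

variable {n : ℕ}

theorem comm_s' (h : IsCurrentSystem q M s p s' p') (hn : CommUpTo M s p n) (m : ℕ) (hm : m ≤ n) :
    M * M * s' m = s' m * (M * M) := by
  rcases m with _ | m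
  · simp [h.s'_zero]
  · have h1 := hn.comm_s (m + 1) hm
    have h2 := hn.comm_p m (by omega)
    rw [h.s'_succ_eq]
    linear_combination (norm := noncomm_ring) h1 - M * h2 + h2 * M

theorem lie_p' (h : IsCurrentSystem q M s p s' p') (hn : CommUpTo M s p n) (m : ℕ) (hm : m ≤ n) :
    M * M * p' m - p' m * (M * M) = M * M * p m - p m * (M * M) := by
  have h1 := hn.comm_s m hm
  rw [h.p'_eq]
  linear_combination (norm := noncomm_ring) -M * h1 - h1 * M

theorem m_comm_p' (h : IsCurrentSystem q M s p s' p') (hn : CommUpTo M s p n) (m : ℕ)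
    (hm : m ≤ n) : M * p' m - p' m * M = s (m + 1) - s' (m + 1) := by
  have h1 := hn.comm_s m hm
  rw [h.p'_eq, ← h.m_comm_p]
  linear_combination (norm := noncomm_ring) -h1

theorem s'_succ (h : IsCurrentSystem q M s p s' p') (hn : CommUpTo M s p n) (hθ : θ q ≠ 0)
    (m : ℕ) (hm : m ≤ n) :
    (2 : ℂ) • s' (m + 1) = (p 1 * s' m - s' m * p 1) + θ q • (p m * M + M * p' m) := by
  rcases m with _ | m
  · have := h.s'_succ_eq 0
    rw [h.s'_zero, this, h.p_zero, h.p'_zero, h.s_one]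
    simp only [expand_rules]
    match_scalars <;> field_simp <;> ring
  · rw [h.s'_succ, hn.comm_s' h _ hm, hn.comm_p m (by omega)]
    simp only [sub_self, smul_zero, sub_zero]
    rfl

theorem s_succ (h : IsCurrentSystem q M s p s' p') (hn : CommUpTo M s p n)
    (m : ℕ) (hm : m ≤ n) :
    (2 : ℂ) • s (m + 1) = -(p 1 * s m - s m * p 1) + θ q • (p' m * M + M * p m) := by
  rw [h.s_succ, hn.comm_s _ hm, sub_self, smul_zero, add_zero]
  rfl

/-- `2βₘ₊₁ = -∂bₘ`. -/
theorem sub_succ (h : IsCurrentSystem q M s p s' p') (hn : CommUpTo M s p n) (hθ : θ q ≠ 0)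
    (m : ℕ) (hm : m ≤ n) :
    s (m + 1) - s' (m + 1) = -(p 1 * ((2 : ℂ)⁻¹ • (s m + s' m))
      - ((2 : ℂ)⁻¹ • (s m + s' m)) * p 1) := by
  have h1 := hn.s_succ h m hm
  have h2 := hn.s'_succ h hθ m hm
  have h3 := h.m_comm_p m
  have h4 := hn.m_comm_p' h m hm
  linear_combination (norm := skip) (1 / 2 : ℂ) • h1 - (1 / 2 : ℂ) • h2 + (θ q / 2) • (h3 - h4)
  simp only [expand_rules]
  match_scalars <;> ring

/-- `bₘ₊₁ = (θ/2){aₘ, M} - ½∂βₘ`. -/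
theorem avg_succ (h : IsCurrentSystem q M s p s' p') (hn : CommUpTo M s p n) (hθ : θ q ≠ 0)
    (m : ℕ) (hm : m ≤ n) :
    (2 : ℂ)⁻¹ • (s (m + 1) + s' (m + 1))
      = (θ q / 2) • (((2 : ℂ)⁻¹ • (p m + p' m)) * M + M * ((2 : ℂ)⁻¹ • (p m + p' m)))
        - (1 / 4 : ℂ) • (p 1 * (s m - s' m) - (s m - s' m) * p 1) := by
  have h1 := hn.s_succ h m hm
  have h2 := hn.s'_succ h hθ m hm
  linear_combination (norm := skip) (1 / 4 : ℂ) • h1 + (1 / 4 : ℂ) • h2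
  simp only [expand_rules]
  match_scalars <;> ring

theorem m_anti_s' (h : IsCurrentSystem q M s p s' p') (hn : CommUpTo M s p n) (m : ℕ)
    (hm : m ≤ n) : M * s' m + s' m * M = p m - p' m := by
  rcases m with _ | m
  · simp [h.s'_zero, h.p_zero, h.p'_zero]
  · rw [h.s'_succ_eq, ← h.m_anti_s]
    linear_combination (norm := noncomm_ring) -hn.comm_p m (by omega)

theorem lie_avg_p (h : IsCurrentSystem q M s p s' p') (hn : CommUpTo M s p n) (m : ℕ)
    (hm : m < n) : p 1 * (p m + p' m) = (p m + p' m) * p 1 := by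
  have h1 := h.lie_p m
  have h2 := h.lie_p' m
  rw [hn.lie_p' h m hm.le, hn.comm_s m hm.le] at h2
  rw [hn.comm_p m hm] at h1 h2
  have h3 := hn.comm_s (m + 1) hm
  have h4 := hn.comm_s' h (m + 1) hm
  have h5 := h.m_anti_s (m + 1)
  have h6 := hn.m_anti_s' h (m + 1) hm
  linear_combination (norm := skip) h1 + h2 + (q - q⁻¹) • (h5 - h6)
  simp only [expand_rules]
  match_scalars <;> ring

/-- The commutator of `aₘ` with `M`, for every integer `m ≤ n`. -/
theorem average_m (h : IsCurrentSystem q M s p s' p') (hn : CommUpTo M s p n) (hθ : θ q ≠ 0)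
    (m : ℤ) (hm : m ≤ n) :
    average p p' m * M - M * average p p' m
      = p 1 * average s s' m - average s s' m * p 1 := by
  rcases lt_or_ge m 0 with h0 | h0
  · simp [average_of_neg _ _ h0]
  · lift m to ℕ using h0
    have hm' : m ≤ n := by omega
    rw [average_natCast, average_natCast]
    have h1 := h.m_comm_p m
    have h2 := hn.m_comm_p' h m hm'
    have h3 := hn.sub_succ h hθ m hm'
    linear_combination (norm := skip) -(1 / 2 : ℂ) • h1 - (1 / 2 : ℂ) • h2 - h3
    simp only [expand_rules]
    match_scalars <;> ring

theorem average_s_succ (h : IsCurrentSystem q M s p s' p') (hn : CommUpTo M s p n)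
    (hθ : θ q ≠ 0) (m : ℤ) (hm : m ≤ n) :
    average s s' (m + 1) = (θ q / 2) • (average p p' m * M + M * average p p' m)
      + (1 / 4 : ℂ) • (p 1 * (p 1 * average s s' (m - 1) - average s s' (m - 1) * p 1)
        - (p 1 * average s s' (m - 1) - average s s' (m - 1) * p 1) * p 1) := by
  rcases lt_or_ge m 0 with h0 | h0
  · rw [average_of_neg p p' h0, average_of_neg s s' (by omega : m - 1 < 0)]
    rcases eq_or_lt_of_le (by omega : m + 1 ≤ 0) with h1 | h1
    · rw [h1]; simp [average, h.s_zero, h.s'_zero]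
    · rw [average_of_neg _ _ h1]; simp
  · lift m to ℕ using h0
    have hm' : m ≤ n := by omega
    have h1 := hn.avg_succ h hθ m hm'
    rw [← average_natCast, ← average_natCast] at h1
    push_cast at h1
    rw [h1]
    rcases m with _ | m
    · rw [average_of_neg s s' (by simp)]
      simp [h.s_zero, h.s'_zero]
    · have h2 := hn.sub_succ h hθ m (by omega)
      rw [h2, ← average_natCast]
      push_cast
      rw [add_sub_cancel_right]
      simp only [expand_rules]
      match_scalars <;> ring

theorem lie_average (h : IsCurrentSystem q M s p s' p') (hn : CommUpTo M s p n)
    (m : ℤ) (hm : m < n) :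
    p 1 * average p p' m = average p p' m * p 1 := by
  rcases lt_or_ge m 0 with h0 | h0
  · simp [average_of_neg _ _ h0]
  · lift m to ℕ using h0
    rw [average_natCast, mul_smul_comm, smul_mul_assoc, hn.lie_avg_p h m (by omega)]

end CommUpTo

end IsCurrentSystem
section Step

variable {A : Type*} [Ring A] [Algebra ℂ A] {q : ℂ}

theorem rule_zero_aux {t : ℂ} {a a₁ a₂ b b₂ D M : A}
    (h1 : a * M - M * a = D * b - b * D)
    (h2 : b = (t / 2) • (a₁ * M + M * a₁)
      + (1 / 4 : ℂ) • (D * (D * b₂ - b₂ * D) - (D * b₂ - b₂ * D) * D))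
    (h3 : a₂ * M - M * a₂ = D * b₂ - b₂ * D) (hd1 : D * a₁ = a₁ * D) (hd2 : D * a₂ = a₂ * D) :
    a * M = M * a + (t / 2) • (a₁ * (D * M - M * D) + (D * M - M * D) * a₁)
      + (1 / 4 : ℂ) • (a₂ * (D * (D * M - M * D) - (D * M - M * D) * D)
        - (D * (D * M - M * D) - (D * M - M * D) * D) * a₂) := by
  rw [← h3] at h2
  rw [h2] at h1
  linear_combination (norm := skip) h1
  simp only [expand_rules, hd1, hd2, mul_mul_of_mul_eq hd1, mul_mul_of_mul_eq hd2]
  match_scalars <;> ring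

theorem rule_succ_aux {t : ℂ} {a a₁ a₂ D N N₁ N₂ : A}
    (h : a * N = N * a + (t / 2) • (a₁ * N₁ + N₁ * a₁) + (1 / 4 : ℂ) • (a₂ * N₂ - N₂ * a₂))
    (hd : D * a = a * D) (hd1 : D * a₁ = a₁ * D) (hd2 : D * a₂ = a₂ * D) :
    a * (D * N - N * D) = (D * N - N * D) * a
      + (t / 2) • (a₁ * (D * N₁ - N₁ * D) + (D * N₁ - N₁ * D) * a₁)
      + (1 / 4 : ℂ) • (a₂ * (D * N₂ - N₂ * D) - (D * N₂ - N₂ * D) * a₂) := by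
  linear_combination (norm := skip) D * h - h * D
  simp only [expand_rules, hd, hd1, hd2, mul_mul_of_mul_eq hd, mul_mul_of_mul_eq hd1,
    mul_mul_of_mul_eq hd2]
  match_scalars <;> ring

/-- Computing `{∂M, b}` in two ways. -/
theorem two_ways_aux {t : ℂ} {a a₁ a₂ b b' α β z D M M₁ : A} (hD : D * M = M * D + M₁)
    (h1 : M * b + b * M = (2 : ℂ) • α)
    (h2 : D * α - α * D = z + t • (M * b' - b' * M))
    (h3 : M * (D * b - b * D) + (D * b - b * D) * M = -z)
    (h4 : b' = (t / 2) • (a * M + M * a) - (1 / 2 : ℂ) • (D * β - β * D))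
    (hz : M * M * a - a * (M * M) = z)
    (h5 : b = (t / 2) • (a₁ * M + M * a₁) + (1 / 4 : ℂ) • (a₂ * M₁ - M₁ * a₂))
    (h6 : M₁ * M = -(M * M₁)) (h7 : a₁ * M = M * a₁ - (2 : ℂ) • β) (h8 : D * a₁ = a₁ * D) :
    a₂ * (M₁ * M₁) - M₁ * M₁ * a₂ = (4 * (3 + t ^ 2)) • z := by
  have e1 : M₁ * b + b * M₁ = (3 : ℂ) • z + (2 * t) • (M * b' - b' * M) := by
    have : D * (M * b + b * M) - (M * b + b * M) * D = (2 : ℂ) • (D * α - α * D) := by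
      rw [h1]; simp only [expand_rules]
    rw [h2] at this
    linear_combination (norm := skip) this - h3
    simp only [expand_rules, hD, mul_mul_of_mul_eq hD]
    match_scalars <;> ring
  have e2 : M * b' - b' * M = (t / 2) • z
      - (1 / 2 : ℂ) • (M * (D * β - β * D) - (D * β - β * D) * M) := by
    rw [h4, ← hz]
    simp only [expand_rules]
    match_scalars <;> ring
  have e3 : a₁ * M₁ = M₁ * a₁ - (2 : ℂ) • (D * β - β * D) := by
    linear_combination (norm := skip) D * h7 - h7 * D
    simp only [expand_rules, hD, mul_mul_of_mul_eq hD, h8, mul_mul_of_mul_eq h8]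
    match_scalars <;> ring
  have e4 : M₁ * b + b * M₁ = -t • (M * (D * β - β * D) - (D * β - β * D) * M)
      + (1 / 4 : ℂ) • (a₂ * (M₁ * M₁) - M₁ * M₁ * a₂) := by
    generalize D * β - β * D = γ at *
    rw [h5]
    have h6' : M * M₁ = -(M₁ * M) := by rw [h6, neg_neg]
    simp only [expand_rules, h6', mul_mul_of_mul_eq h6', e3, mul_mul_of_mul_eq e3]
    match_scalars <;> ring
  rw [e2] at e1
  linear_combination (norm := skip) (4 : ℂ) • e1 - (4 : ℂ) • e4
  simp only [expand_rules]
  match_scalars <;> ring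

end Step

namespace IsCurrentSystem

variable {A : Type*} [Ring A] [Algebra ℂ A] {q : ℂ} {M : A} {s p s' p' : ℕ → A}

namespace CommUpTo

variable {n : ℕ}

theorem average_zero (h : IsCurrentSystem q M s p s' p') : average p p' 0 = (θ q)⁻¹ • 1 := by
  rw [← Nat.cast_zero, average_natCast, h.p_zero, h.p'_zero]
  match_scalars; ring

theorem isTower (h : IsCurrentSystem q M s p s' p') (hn : CommUpTo M s p n) (hθ : θ q ≠ 0) :
    IsTower q n (average p p') (p 1) (iterLie (p 1) M) := by
  have h0 : ∀ m : ℤ, m ≤ n → average p p' m * M = M * average p p' m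
      + (θ q / 2) • (average p p' (m - 1) * iterLie (p 1) M 1
        + iterLie (p 1) M 1 * average p p' (m - 1))
      + (1 / 4 : ℂ) • (average p p' (m - 2) * iterLie (p 1) M 2
        - iterLie (p 1) M 2 * average p p' (m - 2)) := by
    intro m hm
    have e := hn.average_s_succ h hθ (m - 1) (by omega)
    rw [sub_add_cancel, show m - 1 - 1 = m - 2 by ring] at e
    exact rule_zero_aux (hn.average_m h hθ m hm) e (hn.average_m h hθ (m - 2) (by omega))
      (hn.lie_average h _ (by omega)) (hn.lie_average h _ (by omega))
  refine ⟨average_zero h, fun m hm => average_of_neg _ _ hm, fun k => rfl, ?_, hn.anti⟩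
  rintro m k (hm | ⟨rfl, rfl⟩)
  · induction k with
    | zero => exact h0 m hm.le
    | succ k ih =>
      exact rule_succ_aux ih (hn.lie_average h _ (by omega)) (hn.lie_average h _ (by omega))
        (hn.lie_average h _ (by omega))
  · exact h0 _ le_rfl

theorem lie_average_sq (h : IsCurrentSystem q M s p s' p') (hn : CommUpTo M s p n) :
    M * M * average p p' n - average p p' n * (M * M) = M * M * p n - p n * (M * M) := by
  have := hn.lie_p' h n le_rfl
  rw [average_natCast]
  linear_combination (norm := skip) (1 / 2 : ℂ) • this
  simp only [expand_rules]
  match_scalars <;> ring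

theorem m_anti_iterLie (h : IsCurrentSystem q M s p s' p') :
    iterLie (p 1) M 1 * M = -(M * iterLie (p 1) M 1) := by
  have := h.lie_sq
  simp only [iterLie]
  linear_combination (norm := noncomm_ring) this

theorem two_ways (h : IsCurrentSystem q M s p s' p') (hn : CommUpTo M s p (n + 2)) (hθ : θ q ≠ 0) :
    average p p' n * (iterLie (p 1) M 1 * iterLie (p 1) M 1)
      - iterLie (p 1) M 1 * iterLie (p 1) M 1 * average p p' n
      = (4 * (3 + θ q ^ 2)) • (M * M * p (n + 2) - p (n + 2) * (M * M)) := by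
  refine two_ways_aux (D := p 1) (a := average p p' (n + 2 : ℕ)) (a₁ := average p p' (n + 1 : ℕ))
    (b := average s s' (n + 2 : ℕ)) (b' := average s s' (n + 3 : ℕ))
    (α := (2 : ℂ)⁻¹ • (p (n + 2) - p' (n + 2))) (β := (2 : ℂ)⁻¹ • (s (n + 2) - s' (n + 2)))
    (M := M) (by simp [iterLie]) ?_ ?_ ?_ ?_ ?_ ?_ (m_anti_iterLie h) ?_ ?_
  · rw [average_natCast]
    have e1 := h.m_anti_s (n + 2)
    have e2 := hn.m_anti_s' h (n + 2) le_rfl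
    linear_combination (norm := skip) (1 / 2 : ℂ) • e1 + (1 / 2 : ℂ) • e2
    simp only [expand_rules]
    match_scalars <;> ring
  · rw [average_natCast]
    have e1 := h.lie_p (n + 2)
    have e2 := h.lie_p' (n + 2)
    rw [hn.lie_p' h _ le_rfl, hn.comm_s _ le_rfl] at e2
    rw [show q - q⁻¹ = θ q from rfl] at e1 e2
    linear_combination (norm := skip) (1 / 2 : ℂ) • e1 - (1 / 2 : ℂ) • e2
    simp only [expand_rules]
    match_scalars <;> ring
  · rw [average_natCast]
    have e1 := h.m_comm_p (n + 2)
    have e2 := hn.sub_succ h hθ (n + 2) le_rfl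
    rw [← e1] at e2
    linear_combination (norm := skip) M * e2 + e2 * M
    simp only [expand_rules]
    match_scalars <;> ring
  · have e := hn.avg_succ h hθ (n + 2) le_rfl
    rw [average_natCast, average_natCast, e]
    simp only [expand_rules]
    match_scalars <;> ring
  · exact hn.lie_average_sq h
  · have e := hn.average_s_succ h hθ (n + 1 : ℕ) (by push_cast; omega)
    have e1 := hn.average_m h hθ n (by push_cast; omega)
    have e2 := hn.lie_average h n (by push_cast; omega)
    push_cast at e ⊢
    rw [show (n : ℤ) + 1 + 1 = n + 2 by ring, add_sub_cancel_right, ← e1] at e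
    rw [e]
    congr 2
    simp only [iterLie]
    linear_combination (norm := noncomm_ring) e2 * M - M * e2
  · rw [average_natCast]
    have e1 := h.m_comm_p (n + 1)
    have e2 := hn.m_comm_p' h (n + 1) (by omega)
    linear_combination (norm := skip) -(1 / 2 : ℂ) • e1 - (1 / 2 : ℂ) • e2
    simp only [expand_rules]
    match_scalars <;> ring
  · exact hn.lie_average h _ (by push_cast; omega)

end CommUpTo

end IsCurrentSystem
theorem pow_sub_inv_pow_ne_zero {q : ℂ} (hq : q ≠ 0) (hr : ∀ n : ℕ, n ≠ 0 → q ^ n ≠ 1) (n : ℕ)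
    (hn : n ≠ 0) : q ^ n - q⁻¹ ^ n ≠ 0 := by
  intro h
  have h1 : q ^ n * q⁻¹ ^ n = 1 := by rw [← mul_pow, mul_inv_cancel₀ hq, one_pow]
  apply hr (2 * n) (by omega)
  rw [two_mul, pow_add]
  linear_combination q ^ n * h + h1

namespace IsCurrentSystem

variable {A : Type*} [Ring A] [Algebra ℂ A] {q : ℂ} {M : A} {s p s' p' : ℕ → A}

namespace CommUpTo

variable {n : ℕ}

theorem succ_of_odd (h : IsCurrentSystem q M s p s' p') {k : ℕ}
    (hn : CommUpTo M s p (2 * k + 3)) (hq : q ≠ 0) (hr : ∀ n : ℕ, n ≠ 0 → q ^ n ≠ 1) :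
    M * M * p (2 * k + 3) = p (2 * k + 3) * (M * M) ∧
      iterLie (p 1) M (k + 1) * iterLie (p 1) M (k + 2)
        + iterLie (p 1) M (k + 2) * iterLie (p 1) M (k + 1) = 0 := by
  have hθ : θ q ≠ 0 := by
    have := pow_sub_inv_pow_ne_zero hq hr 1 one_ne_zero
    rwa [pow_one, pow_one] at this
  have hq4 : q + q⁻¹ ≠ 0 := by
    intro h0
    apply pow_sub_inv_pow_ne_zero hq hr 2 two_ne_zero
    linear_combination (q - q⁻¹) * h0
  have ht := hn.isTower h hθ
  have e1 := ht.lie_sq_odd hq hθ (k + 1) (by omega) (k + 1) 0 (by omega) (by omega)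
  have e2 := ht.lie_sq_odd hq hθ (k + 1) (by omega) k 1 (by omega) (by omega)
  have e3 := two_ways (n := 2 * k + 1) h hn hθ
  have e4 := hn.lie_average_sq h
  rw [e3] at e2
  rw [show 2 * (k + 1) + 1 = 2 * k + 3 by ring] at e1
  have e0 : iterLie (p 1) M 0 = M := rfl
  rw [e0] at e1
  rw [show 2 * k + 1 + 2 = 2 * k + 3 by ring] at e2
  have hr1 : q * q⁻¹ = 1 := mul_inv_cancel₀ hq
  set z := M * M * p (2 * k + 3) - p (2 * k + 3) * (M * M) with hz
  rw [← neg_sub, e4] at e1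
  have hy : ((q + q⁻¹) * (q ^ (2 * k + 4) - q⁻¹ ^ (2 * k + 4))) •
      (iterLie (p 1) M (k + 1) * iterLie (p 1) M (k + 1 + 1)
        + iterLie (p 1) M (k + 1 + 1) * iterLie (p 1) M (k + 1)) = 0 := by
    have : (q + q⁻¹) * (q ^ (2 * k + 4) - q⁻¹ ^ (2 * k + 4))
        = (3 + θ q ^ 2) * (q ^ (2 * k + 3) - q⁻¹ ^ (2 * k + 3))
          - (q ^ (2 * k + 1) - q⁻¹ ^ (2 * k + 1)) := by
      simp only [θ]
      generalize q⁻¹ = r at *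
      linear_combination (q ^ (2 * k + 1) * (3 * q ^ 2 - q * r - 1)
        - r ^ (2 * k + 1) * (3 * r ^ 2 - q * r - 1)) * hr1
    rw [this, sub_smul, mul_smul, ← e1, ← e2]
    match_scalars <;> ring
  have hy' := (smul_eq_zero.1 hy).resolve_left
    (mul_ne_zero hq4 (pow_sub_inv_pow_ne_zero hq hr _ (by omega)))
  refine ⟨?_, hy'⟩
  rw [hy', smul_zero, smul_neg, neg_eq_zero] at e1
  exact sub_eq_zero.1 ((smul_eq_zero.1 e1).resolve_left
    (mul_ne_zero (pow_ne_zero _ (by norm_num)) hθ))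

theorem succ (h : IsCurrentSystem q M s p s' p') (hn : CommUpTo M s p n) (hq : q ≠ 0)
    (hr : ∀ n : ℕ, n ≠ 0 → q ^ n ≠ 1) : CommUpTo M s p (n + 1) := by
  have hθ : θ q ≠ 0 := by
    have := pow_sub_inv_pow_ne_zero hq hr 1 one_ne_zero
    rwa [pow_one, pow_one] at this
  have key : M * M * p n = p n * (M * M) ∧ ∀ k, 2 * k + 1 = n →
      iterLie (p 1) M k * iterLie (p 1) M (k + 1)
        + iterLie (p 1) M (k + 1) * iterLie (p 1) M k = 0 := by
    rcases Nat.even_or_odd' n with ⟨l, rfl | rfl⟩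
    · refine ⟨?_, fun k hk => by omega⟩
      have e := (hn.isTower h hθ).lie_sq_even l 0 (by omega)
      have e4 := hn.lie_average_sq h
      have e0 : iterLie (p 1) M 0 = M := rfl
      rw [← neg_sub, e0, e4, neg_eq_zero] at e
      exact sub_eq_zero.1 e
    · rcases l with _ | l
      · refine ⟨h.lie_sq.symm, fun k hk => ?_⟩
        obtain rfl : k = 0 := by omega
        have e0 : iterLie (p 1) M 0 = M := rfl
        rw [e0, m_anti_iterLie h, add_neg_cancel]
      · have := succ_of_odd (k := l) h hn hq hr
        refine ⟨this.1, fun k hk => ?_⟩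
        obtain rfl : k = l + 1 := by omega
        exact this.2
  have hp' := hn.lie_p' h n le_rfl
  rw [key.1, sub_self, sub_eq_zero] at hp'
  refine ⟨fun m hm => ?_, fun m hm => ?_, fun k hk => ?_⟩
  · rcases (Nat.lt_succ_iff_lt_or_eq.1 hm) with hm | rfl
    · exact hn.comm_p m hm
    · exact key.1
  · rcases hm.lt_or_eq with hm | rfl
    · exact hn.comm_s m (by omega)
    · have e := hn.s_succ h n le_rfl
      have e1 := hn.comm_s n le_rfl
      have e2 := h.lie_sq
      have : (2 : ℂ) • (M * M * s (n + 1)) = (2 : ℂ) • (s (n + 1) * (M * M)) := by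
        rw [← mul_smul_comm, ← smul_mul_assoc, e]
        linear_combination (norm := skip) -(p 1 * e1) + e1 * p 1 + e2 * s n - s n * e2
          + θ q • (hp' * M) + θ q • (M * key.1)
        simp only [expand_rules]
        match_scalars <;> ring
      exact smul_right_injective A (two_ne_zero (α := ℂ)) this
  · rcases (by omega : 2 * k + 1 < n ∨ 2 * k + 1 = n) with hk | hk
    · exact hn.anti k hk
    · exact key.2 k hk

end CommUpTo

theorem commUpTo (h : IsCurrentSystem q M s p s' p') (hq : q ≠ 0)
    (hr : ∀ n : ℕ, n ≠ 0 → q ^ n ≠ 1) (n : ℕ) : CommUpTo M s p n := by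
  induction n with
  | zero =>
    refine ⟨fun m hm => by omega, fun m hm => ?_, fun k hk => by omega⟩
    obtain rfl : m = 0 := by omega
    simp [h.s_zero]
  | succ n ih => exact ih.succ h hq hr

end IsCurrentSystem

section Aux

variable {A : Type*} [Ring A] [Algebra ℂ A] {q : ℂ} {M : A}

theorem bracket_eq_of_shift {c : ℂ} {C : A} {x y f : ℕ → A}
    (hx : ∀ i, x (i + 1) = x i * C - C * x i) (hy : ∀ i, y (i + 1) = C * y i - y i * C)
    (hf : ∀ j, x 0 * y j - c • (y j * x 0) = f j) (hC : ∀ j, C * f j = f j * C) (i : ℕ) :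
    ∀ j, x i * y j - c • (y j * x i) = f (i + j) := by
  induction i with
  | zero => intro j; rw [hf, zero_add]
  | succ i ih =>
    intro j
    have e := hC (i + j)
    rw [show i + 1 + j = i + (j + 1) by ring, ← ih (j + 1), hx, hy]
    rw [← ih] at e
    linear_combination (norm := skip) -e
    simp only [expand_rules]
    match_scalars <;> ring

theorem lie_shift_of_comm {e : ℂ} {y w : ℕ → A} {D p : A} {c d : ℂ}
    (hy : ∀ i, y (i + 1) = D * y i - y i * D) (hw : ∀ i, w (i + 1) = D * w i - w i * D)
    (hp : D * p = p * D) {s : A} (hs : D * s = s * D)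
    (h : p * y 0 + e • (y 0 * p) = c • (s * w 0) + d • (w 0 * s)) (i : ℕ) :
    p * y i + e • (y i * p) = c • (s * w i) + d • (w i * s) := by
  induction i with
  | zero => exact h
  | succ i ih =>
    rw [hy, hw]
    linear_combination (norm := skip) D * ih - ih * D
    simp only [expand_rules, hp, hs, mul_mul_of_mul_eq hp, mul_mul_of_mul_eq hs]
    match_scalars <;> ring

theorem bracket_serre_y_aux (hq : q ≠ 0) {x y w : A} (ε : ℂ) (hs : w * y = q • (y * w)) :
    (x * w - q⁻¹ • (w * x)) * y + ε • (y * (x * w - q⁻¹ • (w * x)))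
      = q • ((x * y + (ε * q⁻¹) • (y * x)) * w)
        + -q⁻¹ • (w * (x * y + (ε * q⁻¹) • (y * x))) := by
  simp only [expand_rules, hs, mul_mul_of_mul_eq hs]
  match_scalars <;> field_simp

theorem anti_y_aux {y w Y₃ s s₁ s₁' p p' : A} (hw : w = M * y + y * M) (hY : Y₃ = M * w - w * M)
    (h1 : M * p = p * M + s₁ - s₁') (h2 : M * s = p - p' - s * M)
    (h3 : p * y = y * p + (q • (s * w) - q⁻¹ • (w * s)))
    (h4 : s₁' * y + y * s₁' = q • (p' * w) - q⁻¹ • (w * p')) :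
    s₁ * y + y * s₁ = (q - 1) • (p * w) + (1 - q⁻¹) • (w * p) - q • (s * Y₃) - q⁻¹ • (Y₃ * s) := by
  have hy : M * y = w - y * M := by rw [hw]; abel
  have hY : M * w = w * M + Y₃ := by rw [hY]; abel
  linear_combination (norm := skip) h4 + M * h3 + h3 * M
  simp only [expand_rules, h1, h2, hy, hY, mul_mul_of_mul_eq h1, mul_mul_of_mul_eq h2,
    mul_mul_of_mul_eq hy, mul_mul_of_mul_eq hY]
  match_scalars <;> ring

theorem comm_y_aux {y w Y₃ s₁ s₁' p₁ p₁' p' : A} (hw : w = M * y + y * M)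
    (hY : Y₃ = M * w - w * M)
    (h1 : M * p' = p' * M + s₁ - s₁') (h2 : M * s₁' = p₁ - p₁' - s₁' * M)
    (h3 : p₁ * y = y * p₁ + (q • (s₁ * w) - q⁻¹ • (w * s₁)))
    (h4 : s₁' * y + y * s₁' = q • (p' * w) - q⁻¹ • (w * p')) :
    p₁' * y = y * p₁' + ((q - 1) • (s₁' * w) + (1 - q⁻¹) • (w * s₁') - q • (p' * Y₃)
      + q⁻¹ • (Y₃ * p')) := by
  have hy : M * y = w - y * M := by rw [hw]; abel
  have hY : M * w = w * M + Y₃ := by rw [hY]; abel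
  linear_combination (norm := skip) h3 - M * h4 + h4 * M
  simp only [expand_rules, h1, h2, hy, hY, mul_mul_of_mul_eq h1, mul_mul_of_mul_eq h2,
    mul_mul_of_mul_eq hy, mul_mul_of_mul_eq hY]
  match_scalars <;> ring

theorem symm_anti_aux (hq : q ≠ 0) {x z y w s p s₁' p' : A}
    (hx1 : x * s₁' = s₁' * x + (q • (z * p) - q⁻¹ • (p * z)))
    (hx2 : x * p' = p' * x + (q • (z * s) + q⁻¹ • (s * z)))
    (hy1 : y * s₁' = -(s₁' * y) + (q • (p' * w) - q⁻¹ • (w * p')))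
    (hy2 : p * y = y * p + (q • (s * w) - q⁻¹ • (w * s))) :
    (x * y - q⁻¹ • (y * x)) * s₁' + s₁' * (x * y - q⁻¹ • (y * x))
        - q • (p' * (x * w - q⁻¹ • (w * x))) + q⁻¹ • ((x * w - q⁻¹ • (w * x)) * p')
      = s * (z * w - q⁻¹ • (w * z)) + (z * w - q⁻¹ • (w * z)) * s
        - q • ((z * y + q⁻¹ • (y * z)) * p) + q⁻¹ • (p * (z * y + q⁻¹ • (y * z))) := by
  simp only [expand_rules, hx1, hx2, hy1, hy2, mul_mul_of_mul_eq hx1, mul_mul_of_mul_eq hx2,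
    mul_mul_of_mul_eq hy1, mul_mul_of_mul_eq hy2]
  match_scalars <;> field_simp <;> ring

theorem symm_comm_aux (hq : q ≠ 0) {x z y w Y₃ s p p' s₁ s₁' p₁' : A}
    (hx1 : x * s₁' = s₁' * x + (q • (z * p) - q⁻¹ • (p * z)))
    (hx2 : x * p' = p' * x + (q • (z * s) + q⁻¹ • (s * z)))
    (hx3 : x * p₁' = p₁' * x + (q • (z * s₁) + q⁻¹ • (s₁ * z)))
    (hy1 : s₁ * y = -(y * s₁) + ((q - 1) • (p * w) + (1 - q⁻¹) • (w * p)
      - q • (s * Y₃) - q⁻¹ • (Y₃ * s)))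
    (hy2 : p₁' * y = y * p₁' + ((q - 1) • (s₁' * w) + (1 - q⁻¹) • (w * s₁') - q • (p' * Y₃)
      + q⁻¹ • (Y₃ * p'))) :
    (x * y - q⁻¹ • (y * x)) * p₁' - p₁' * (x * y - q⁻¹ • (y * x))
        + q • ((z * y + q⁻¹ • (y * z)) * s₁) - q⁻¹ • (s₁ * (z * y + q⁻¹ • (y * z)))
        + (q - 1) • (s₁' * (x * w - q⁻¹ • (w * x)))
        + (1 - q⁻¹) • ((x * w - q⁻¹ • (w * x)) * s₁')
      = s * (z * Y₃ + q⁻¹ • (Y₃ * z)) - (z * Y₃ + q⁻¹ • (Y₃ * z)) * s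
        + q • (p' * (x * Y₃ - q⁻¹ • (Y₃ * x))) - q⁻¹ • ((x * Y₃ - q⁻¹ • (Y₃ * x)) * p')
        + (q - 1) • ((z * w - q⁻¹ • (w * z)) * p)
        + (1 - q⁻¹) • (p * (z * w - q⁻¹ • (w * z))) := by
  have hy2 : y * p₁' = p₁' * y - ((q - 1) • (s₁' * w) + (1 - q⁻¹) • (w * s₁') - q • (p' * Y₃)
      + q⁻¹ • (Y₃ * p')) := by rw [hy2, add_sub_cancel_right]
  simp only [expand_rules, hx1, hx2, hx3, hy1, hy2, mul_mul_of_mul_eq hx1, mul_mul_of_mul_eq hx2,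
    mul_mul_of_mul_eq hx3, mul_mul_of_mul_eq hy1, mul_mul_of_mul_eq hy2]
  match_scalars <;> field_simp <;> ring

end Aux

/-- Half-sums `a`, `b` and half-differences `α`, `β` of the two families of imaginary root vectors
(of even, resp. odd, height), with `D = L₂`. -/
structure IsLoopSystem {A : Type*} [Ring A] [Algebra ℂ A] (q : ℂ) (M D : A) (a b α β : ℤ → A) :
    Prop where
  a_zero : a 0 = (θ q)⁻¹ • 1
  a_neg : ∀ m < 0, a m = 0
  b_nonpos : ∀ m ≤ 0, b m = 0
  lie_m : ∀ m, a m * M = M * a m + (D * b m - b m * D)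
  comm : ∀ m, D * a m = a m * D
  b_succ : ∀ m, b (m + 1) = (θ q / 2) • (a m * M + M * a m)
    + (1 / 4 : ℂ) • iterLie D (b (m - 1)) 2
  anti_b : ∀ m, M * b m + b m * M = (2 : ℂ) • α m
  beta_succ : ∀ m, β (m + 1) = -(1 / 2 : ℂ) • (D * b m - b m * D)
  anti_beta : ∀ m, M * β m + β m * M = 0
  comm_alpha : ∀ m, M * α m = α m * M
  comm_sq : ∀ m k, a m * (iterLie D M k * iterLie D M k) = iterLie D M k * iterLie D M k * a m
  alpha_one : ∀ m, α 1 * α m = α m * α 1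
  symm_anti : ∀ m n, 1 ≤ m → 1 ≤ n →
    (b m + β m) * (b (n + 1) - β (n + 1)) + (b (n + 1) - β (n + 1)) * (b m + β m)
        - q • ((a n - α n) * (a m + α m)) + q⁻¹ • ((a m + α m) * (a n - α n))
      = (b n + β n) * (b (m + 1) - β (m + 1)) + (b (m + 1) - β (m + 1)) * (b n + β n)
        - q • ((a m - α m) * (a n + α n)) + q⁻¹ • ((a n + α n) * (a m - α m))
  symm_comm : ∀ m n, 1 ≤ m → 1 ≤ n →
    (b m + β m) * (a (n + 1) - α (n + 1)) - (a (n + 1) - α (n + 1)) * (b m + β m)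
        + q • ((a m - α m) * (b (n + 1) + β (n + 1)))
        - q⁻¹ • ((b (n + 1) + β (n + 1)) * (a m - α m))
        + (q - 1) • ((b (n + 1) - β (n + 1)) * (a m + α m))
        + (1 - q⁻¹) • ((a m + α m) * (b (n + 1) - β (n + 1)))
      = (b n + β n) * (a (m + 1) - α (m + 1)) - (a (m + 1) - α (m + 1)) * (b n + β n)
        + q • ((a n - α n) * (b (m + 1) + β (m + 1)))
        - q⁻¹ • ((b (m + 1) + β (m + 1)) * (a n - α n))
        + (q - 1) • ((b (m + 1) - β (m + 1)) * (a n + α n))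
        + (1 - q⁻¹) • ((a n + α n) * (b (m + 1) - β (m + 1)))

section Aux

variable {A : Type*} [Ring A] [Algebra ℂ A]

theorem iterLie_succ (D x : A) (k : ℕ) :
    iterLie D x (k + 1) = D * iterLie D x k - iterLie D x k * D := rfl

theorem anti_swap_aux {D a₁ a₂ b₁ b₂ c₁ c₂ M : A} {t : ℂ} (h : a₁ * a₂ = a₂ * a₁)
    (hb₂ : b₂ = t • (a₂ * M + M * a₂) + (1 / 4 : ℂ) • iterLie D c₂ 2)
    (hb₁ : b₁ = t • (a₁ * M + M * a₁) + (1 / 4 : ℂ) • iterLie D c₁ 2)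
    (h1 : D * a₁ = a₁ * D) (h2 : D * a₂ = a₂ * D) :
    a₁ * b₂ + b₂ * a₁ - (a₂ * b₁ + b₁ * a₂)
      = (1 / 4 : ℂ) • iterLie D (a₁ * c₂ + c₂ * a₁ - (a₂ * c₁ + c₁ * a₂)) 2 := by
  rw [hb₁, hb₂]
  simp only [iterLie, expand_rules, h, h1, h2, mul_mul_of_mul_eq h, mul_mul_of_mul_eq h1,
    mul_mul_of_mul_eq h2]
  match_scalars <;> ring

theorem lie_succ_aux {D a₁ a₂ b₁ b₂ c₂ M : A} {t : ℂ} (h : a₁ * a₂ = a₂ * a₁)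
    (hb₂ : b₂ = t • (a₂ * M + M * a₂) + (1 / 4 : ℂ) • iterLie D c₂ 2)
    (hm : a₁ * M = M * a₁ + (D * b₁ - b₁ * D))
    (h1 : D * a₁ = a₁ * D) (h2 : D * a₂ = a₂ * D) :
    a₁ * b₂ - b₂ * a₁ = t • iterLie D (a₂ * b₁ + b₁ * a₂) 1
      + (1 / 4 : ℂ) • iterLie D (a₁ * c₂ - c₂ * a₁) 2 := by
  rw [hb₂]
  simp only [iterLie, expand_rules, h, h1, h2, hm, mul_mul_of_mul_eq h, mul_mul_of_mul_eq h1,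
    mul_mul_of_mul_eq h2, mul_mul_of_mul_eq hm]
  match_scalars <;> ring

end Aux

namespace IsLoopSystem

variable {A : Type*} [Ring A] [Algebra ℂ A] {q : ℂ} {M D : A} {a b α β : ℤ → A}

theorem anti_swap (h : IsLoopSystem q M D a b α β) {m n : ℤ} (hmn : a m * a n = a n * a m) :
    a m * b (n + 1) + b (n + 1) * a m - (a n * b (m + 1) + b (m + 1) * a n)
      = (1 / 4 : ℂ) • iterLie D (a m * b (n - 1) + b (n - 1) * a m
        - (a n * b (m - 1) + b (m - 1) * a n)) 2 :=
  anti_swap_aux hmn (h.b_succ n) (h.b_succ m) (h.comm m) (h.comm n)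

theorem lie_succ (h : IsLoopSystem q M D a b α β) {m n : ℤ} (hmn : a m * a n = a n * a m) :
    a m * b (n + 1) - b (n + 1) * a m = (θ q / 2) • iterLie D (a n * b m + b m * a n) 1
      + (1 / 4 : ℂ) • iterLie D (a m * b (n - 1) - b (n - 1) * a m) 2 :=
  lie_succ_aux hmn (h.b_succ n) (h.lie_m m) (h.comm m) (h.comm n)

/-- `[aₘ, bₙ] = [aₙ, bₘ]` if the `aᵢ` commute in smaller total degree. -/
theorem lie_symm (h : IsLoopSystem q M D a b α β) {N : ℤ}
    (hN : ∀ m n, m + n ≤ N → a m * a n = a n * a m) (k : ℕ) :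
    ∀ m n : ℤ, m + n ≤ k → m + n ≤ N + 1 → a m * b n - b n * a m = a n * b m - b m * a n := by
  induction k with
  | zero =>
    intro m n hk _
    have key : ∀ m n : ℤ, m + n ≤ 0 → a m * b n - b n * a m = 0 := by
      intro m n hmn
      rcases lt_or_ge m 0 with hm | hm
      · simp [h.a_neg m hm]
      · simp [h.b_nonpos n (by omega)]
    rw [key m n (by exact_mod_cast hk), key n m (by rw [add_comm]; exact_mod_cast hk)]
  | succ k ih =>
    intro m n hk hmn
    push_cast at hk
    have e1 := h.lie_succ (hN m (n - 1) (by omega))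
    have e2 := h.lie_succ (hN n (m - 1) (by omega))
    have e3 := h.lie_succ (hN (n - 2) (m - 1) (by omega))
    have e4 := h.lie_succ (hN (m - 2) (n - 1) (by omega))
    have e5 := ih m (n - 2) (by omega) (by omega)
    have e6 := ih n (m - 2) (by omega) (by omega)
    have e7 := ih (n - 2) (m - 2) (by omega) (by omega)
    have e8 := h.anti_swap (hN (n - 1) (m - 1) (by omega))
    simp only [sub_add_cancel, sub_sub] at e1 e2 e3 e4 e8
    norm_num at e1 e2 e3 e4 e8
    rw [e5, e3] at e1
    rw [e6, e4] at e2
    rw [e7] at e1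
    rw [e1, e2, ← sub_eq_zero]
    rw [sub_eq_iff_eq_add] at e8
    rw [e8]
    simp only [iterLie, expand_rules]
    match_scalars <;> ring

end IsLoopSystem

section Aux

variable {A : Type*} [Ring A] [Algebra ℂ A]

theorem iterLie_zero_right (D : A) (k : ℕ) : iterLie D 0 k = 0 := by
  induction k with
  | zero => rfl
  | succ k ih => rw [iterLie_succ, ih]; simp

theorem anti_eq_of_lie_eq {a a' u u' w w' B B' N : A} {t : ℂ}
    (hB : B = t • (a * N + N * a) + (1 / 4 : ℂ) • w)
    (hB' : B' = t • (a' * N + N * a') + (1 / 4 : ℂ) • w')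
    (hu : u * N + N * u = 0) (hu' : u' * N + N * u' = 0)
    (hT : a * u - u * a = a' * u' - u' * a') (hw : w * u + u * w = w' * u' + u' * w') :
    u * B + B * u = u' * B' + B' * u' := by
  have hu : N * u = -(u * N) := by rw [eq_neg_iff_add_eq_zero, add_comm]; exact hu
  have hu' : N * u' = -(u' * N) := by rw [eq_neg_iff_add_eq_zero, add_comm]; exact hu'
  rw [hB, hB']
  linear_combination (norm := skip) t • (N * hT - hT * N) + (1 / 4 : ℂ) • hw
  simp only [expand_rules, hu, hu', mul_mul_of_mul_eq hu, mul_mul_of_mul_eq hu']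
  match_scalars <;> ring

end Aux

namespace IsLoopSystem

variable {A : Type*} [Ring A] [Algebra ℂ A] {q : ℂ} {M D : A} {a b α β : ℤ → A}

theorem a_mul_iterLie (h : IsLoopSystem q M D a b α β) (m : ℤ) (i : ℕ) :
    a m * iterLie D M i = iterLie D M i * a m + iterLie D (b m) (i + 1) := by
  induction i with
  | zero => exact h.lie_m m
  | succ i ih =>
    have hc := h.comm m
    rw [iterLie_succ, iterLie_succ D _ (i + 1)]
    linear_combination (norm := skip) D * ih - ih * D
    simp only [expand_rules, hc, mul_mul_of_mul_eq hc]
    match_scalars <;> ring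

theorem iterLie_b_succ (h : IsLoopSystem q M D a b α β) (m : ℤ) (i : ℕ) :
    iterLie D (b (m + 1)) i = (θ q / 2) • (a m * iterLie D M i + iterLie D M i * a m)
      + (1 / 4 : ℂ) • iterLie D (b (m - 1)) (i + 2) := by
  induction i with
  | zero => exact h.b_succ m
  | succ i ih =>
    have hc := h.comm m
    rw [iterLie_succ, iterLie_succ, show i + 1 + 2 = i + 2 + 1 by ring, iterLie_succ _ _ (i + 2)]
    linear_combination (norm := skip) D * ih - ih * D
    simp only [expand_rules, hc, mul_mul_of_mul_eq hc]
    match_scalars <;> ring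

theorem lie_symm_iterLie (h : IsLoopSystem q M D a b α β) {m n : ℤ}
    (hmn : a m * b n - b n * a m = a n * b m - b m * a n) (i : ℕ) :
    a m * iterLie D (b n) i - iterLie D (b n) i * a m
      = a n * iterLie D (b m) i - iterLie D (b m) i * a n := by
  induction i with
  | zero => exact hmn
  | succ i ih =>
    have hc := h.comm m
    have hc' := h.comm n
    rw [iterLie_succ, iterLie_succ]
    linear_combination (norm := skip) D * ih - ih * D
    simp only [expand_rules, hc, mul_mul_of_mul_eq hc, hc', mul_mul_of_mul_eq hc']
    match_scalars <;> ring

theorem iterLie_b_anti (h : IsLoopSystem q M D a b α β) (m : ℤ) (i : ℕ) :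
    iterLie D (b m) (i + 1) * iterLie D M i + iterLie D M i * iterLie D (b m) (i + 1) = 0 := by
  have e := h.a_mul_iterLie m i
  have e' := h.comm_sq m i
  rw [← sub_eq_zero.2 e']
  simp only [expand_rules, e, mul_mul_of_mul_eq e]
  abel

theorem iterLie_symm (h : IsLoopSystem q M D a b α β) {N : ℤ}
    (hN : ∀ m n, m + n ≤ N → a m * a n = a n * a m) (k : ℕ) :
    ∀ (m n : ℤ) (i : ℕ), m + n ≤ k → m + n ≤ N + 3 →
      iterLie D (b (n - 1)) (i + 1) * iterLie D (b m) i
          + iterLie D (b m) i * iterLie D (b (n - 1)) (i + 1)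
        = iterLie D (b (m - 1)) (i + 1) * iterLie D (b n) i
          + iterLie D (b n) i * iterLie D (b (m - 1)) (i + 1) := by
  induction k with
  | zero =>
    intro m n i hk _
    have : m ≤ 0 ∨ n ≤ 0 := by push_cast at hk; omega
    rcases this with h0 | h0
    · simp [h.b_nonpos _ h0, h.b_nonpos _ (by omega : m - 1 ≤ 0), iterLie_zero_right]
    · simp [h.b_nonpos _ h0, h.b_nonpos _ (by omega : n - 1 ≤ 0), iterLie_zero_right]
  | succ k ih =>
    intro m n i hk hmn
    push_cast at hk
    have e1 := h.iterLie_b_succ (m - 1) i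
    have e2 := h.iterLie_b_succ (n - 1) i
    have e3 := h.lie_symm_iterLie (h.lie_symm hN ((m + n - 2).toNat) (m - 1) (n - 1)
      (by omega) (by omega)) (i + 1)
    have e4 := ih (n - 1) (m - 1) (i + 1) (by omega) (by omega)
    rw [sub_add_cancel] at e1 e2
    exact anti_eq_of_lie_eq e1 e2 (h.iterLie_b_anti _ i) (h.iterLie_b_anti _ i) e3 e4

end IsLoopSystem

section Aux

variable {A : Type*} [Ring A] [Algebra ℂ A] {q : ℂ}

/-- Here `b₁`, `d₁` stand for `bₘ₊₁`, `bₙ₊₁`, and `b`, `d` for `bₘ`, `bₙ`. -/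
theorem lie_eq_lie_aux {M D a a' b d b₁ d₁ b₂ d₂ α α' β β' β₁ β₁' : A}
    (hq : q + q⁻¹ ≠ 0)
    (hb₁ : b₁ = (θ q / 2) • (a * M + M * a) + (1 / 4 : ℂ) • iterLie D b₂ 2)
    (hd₁ : d₁ = (θ q / 2) • (a' * M + M * a') + (1 / 4 : ℂ) • iterLie D d₂ 2)
    (hα : M * b + b * M = (2 : ℂ) • α) (hα' : M * d + d * M = (2 : ℂ) • α')
    (hβ : β = -(1 / 2 : ℂ) • (D * b₂ - b₂ * D)) (hβ' : β' = -(1 / 2 : ℂ) • (D * d₂ - d₂ * D))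
    (hβ₁ : β₁ = -(1 / 2 : ℂ) • (D * b - b * D)) (hβ₁' : β₁' = -(1 / 2 : ℂ) • (D * d - d * D))
    (hT : a * d - d * a = a' * b - b * a')
    (h1 : (D * d₂ - d₂ * D) * b + b * (D * d₂ - d₂ * D)
      = (D * b₂ - b₂ * D) * d + d * (D * b₂ - b₂ * D))
    (h2 : β₁' * b + b * β₁' = β * d₁ + d₁ * β) (h3 : β₁ * d + d * β₁ = β' * b₁ + b₁ * β')
    (hB : (b + β) * (d₁ - β₁') + (d₁ - β₁') * (b + β)
        - q • ((a' - α') * (a + α)) + q⁻¹ • ((a + α) * (a' - α'))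
      = (d + β') * (b₁ - β₁) + (b₁ - β₁) * (d + β')
        - q • ((a - α) * (a' + α')) + q⁻¹ • ((a' + α') * (a - α))) :
    a * a' - a' * a = α * α' - α' * α := by
  have e : β * β₁' + β₁' * β - (β' * β₁ + β₁ * β') = b * ((1 / 4 : ℂ) • iterLie D d₂ 2)
      + ((1 / 4 : ℂ) • iterLie D d₂ 2) * b - (d * ((1 / 4 : ℂ) • iterLie D b₂ 2)
      + ((1 / 4 : ℂ) • iterLie D b₂ 2) * d) := by
    rw [hβ, hβ', hβ₁, hβ₁']
    linear_combination (norm := skip) (-1 / 4 : ℂ) • (D * h1 - h1 * D)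
    simp only [iterLie, expand_rules]
    match_scalars <;> ring
  have e' : b * d₁ + d₁ * b - (d * b₁ + b₁ * d) - (β * β₁' + β₁' * β - (β' * β₁ + β₁ * β'))
      = θ q • (a' * α + α * a' - (a * α' + α' * a)) := by
    have hα : α = (1 / 2 : ℂ) • (M * b + b * M) := by rw [hα, smul_smul]; norm_num
    have hα' : α' = (1 / 2 : ℂ) • (M * d + d * M) := by rw [hα', smul_smul]; norm_num
    rw [e, hb₁, hd₁, hα, hα']
    linear_combination (norm := skip) -(θ q / 2) • (M * hT - hT * M)
    simp only [expand_rules]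
    match_scalars <;> ring
  have : (q + q⁻¹) • (a * a' - a' * a - (α * α' - α' * α)) = 0 := by
    linear_combination (norm := skip) hB + h2 - h3 - e'
    rw [show θ q = q - q⁻¹ from rfl]
    simp only [expand_rules]
    match_scalars <;> ring
  exact sub_eq_zero.1 ((smul_eq_zero.1 this).resolve_left hq)

theorem lie_sub_lie_aux {M D a a' b d α α' β₁ β₁' : A}
    (hm : a * M = M * a + (D * b - b * D)) (hm' : a' * M = M * a' + (D * d - d * D))
    (hα : M * b + b * M = (2 : ℂ) • α) (hα' : M * d + d * M = (2 : ℂ) • α')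
    (hβ₁ : β₁ = -(1 / 2 : ℂ) • (D * b - b * D)) (hβ₁' : β₁' = -(1 / 2 : ℂ) • (D * d - d * D))
    (hT : a * d - d * a = a' * b - b * a') :
    α' * a - a * α' - (α * a' - a' * α) = d * β₁ + β₁ * d - (b * β₁' + β₁' * b) := by
  have hα : α = (1 / 2 : ℂ) • (M * b + b * M) := by rw [hα, smul_smul]; norm_num
  have hα' : α' = (1 / 2 : ℂ) • (M * d + d * M) := by rw [hα', smul_smul]; norm_num
  rw [hα, hα', hβ₁, hβ₁']
  linear_combination (norm := skip) (-1 / 2 : ℂ) • (M * hT + hT * M) 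
  simp only [expand_rules, hm, hm', mul_mul_of_mul_eq hm, mul_mul_of_mul_eq hm']
  match_scalars <;> ring

/-- The anticommutator of `M` with one side of the symmetry relation for commutators. -/
theorem anti_symm_comm_aux {M D a a' b d α α' β β' β₁ β₁' : A}
    (hm : a * M = M * a + (D * b - b * D)) (hm' : a' * M = M * a' + (D * d - d * D))
    (hα : M * b + b * M = (2 : ℂ) • α) (hα' : M * d + d * M = (2 : ℂ) • α')
    (hβ₁ : β₁ = -(1 / 2 : ℂ) • (D * b - b * D)) (hβ₁' : β₁' = -(1 / 2 : ℂ) • (D * d - d * D))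
    (hβ : M * β + β * M = 0) (hβ' : M * β' + β' * M = 0)
    (hmα : M * α = α * M) (hmα' : M * α' = α' * M)
    (hS : α' * a - a * α' - (α * a' - a' * α) = d * β₁ + β₁ * d - (b * β₁' + β₁' * b))
    {E : A} (hE : E = (b + β) * (a' - α') - (a' - α') * (b + β)
        + q • ((a - α) * (d + β')) - q⁻¹ • ((d + β') * (a - α))
        + (q - 1) • ((d - β') * (a + α)) + (1 - q⁻¹) • ((a + α) * (d - β'))) :
    M * E + E * M = (2 : ℂ) • (-(q + q⁻¹) • (α * α' - α' * α)
      + (1 / 2 : ℂ) • (M * (θ q • (a * d + d * a) + (β * a' - a' * β))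
        + (θ q • (a * d + d * a) + (β * a' - a' * β)) * M)
      + (q + q⁻¹ - 1) • (β₁ * β' + β' * β₁)) := by
  have hb : M * b = (2 : ℂ) • α - b * M := by rw [← hα]; abel
  have hd : M * d = (2 : ℂ) • α' - d * M := by rw [← hα']; abel
  have hβ : M * β = -(β * M) := eq_neg_of_add_eq_zero_left hβ
  have hβ' : M * β' = -(β' * M) := eq_neg_of_add_eq_zero_left hβ'
  have ha : M * a = a * M + (2 : ℂ) • β₁ := by
    rw [hm, hβ₁]; module
  have ha' : M * a' = a' * M + (2 : ℂ) • β₁' := by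
    rw [hm', hβ₁']; module
  rw [hE, show θ q = q - q⁻¹ from rfl]
  linear_combination (norm := skip) (-2 : ℂ) • hS
  simp only [expand_rules, hb, hd, hβ, hβ', ha, ha', hmα, hmα', mul_mul_of_mul_eq hb,
    mul_mul_of_mul_eq hd, mul_mul_of_mul_eq hβ, mul_mul_of_mul_eq hβ', mul_mul_of_mul_eq ha,
    mul_mul_of_mul_eq ha', mul_mul_of_mul_eq hmα, mul_mul_of_mul_eq hmα']
  match_scalars <;> ring

end Aux

namespace IsLoopSystem

variable {A : Type*} [Ring A] [Algebra ℂ A] {q : ℂ} {M D : A} {a b α β : ℤ → A}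

theorem anti_beta_succ (h : IsLoopSystem q M D a b α β) {N : ℤ}
    (hN : ∀ m n, m + n ≤ N → a m * a n = a n * a m) {m n : ℤ} (hmn : m + n ≤ N + 2) :
    β (n + 1) * b m + b m * β (n + 1) = β m * b (n + 1) + b (n + 1) * β m := by
  have e := h.iterLie_symm hN (m + (n + 1)).toNat m (n + 1) 0 (by omega) (by omega)
  have e1 := h.beta_succ n
  have e2 := h.beta_succ (m - 1)
  rw [sub_add_cancel] at e2
  rw [add_sub_cancel_right] at e
  rw [e1, e2]
  linear_combination (norm := skip) (-(1 / 2 : ℂ)) • e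
  simp only [iterLie, expand_rules]
  match_scalars <;> ring

theorem lie_a_eq_lie_alpha (h : IsLoopSystem q M D a b α β) (hq : q + q⁻¹ ≠ 0) {N : ℤ}
    (hN : ∀ m n, m + n ≤ N → a m * a n = a n * a m) {m n : ℤ} (hm : 1 ≤ m) (hn : 1 ≤ n)
    (hmn : m + n ≤ N + 1) : a m * a n - a n * a m = α m * α n - α n * α m := by
  have e1 := h.beta_succ (m - 1)
  have e2 := h.beta_succ (n - 1)
  rw [sub_add_cancel] at e1 e2
  exact lie_eq_lie_aux hq (h.b_succ m) (h.b_succ n) (h.anti_b m) (h.anti_b n) e1 e2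
    (h.beta_succ m) (h.beta_succ n)
    (h.lie_symm hN (m + n).toNat m n (by omega) (by omega))
    (h.iterLie_symm hN (m + n).toNat m n 0 (by omega) (by omega))
    (h.anti_beta_succ hN (by omega)) (h.anti_beta_succ hN (by omega)) (h.symm_anti m n hm hn)

theorem lie_beta (h : IsLoopSystem q M D a b α β) (m n : ℤ) :
    β (m + 1) * a n - a n * β (m + 1) = (1 / 2 : ℂ) • iterLie D (a n * b m - b m * a n) 1 := by
  have hc := h.comm n
  rw [h.beta_succ m]
  simp only [iterLie, expand_rules, hc, mul_mul_of_mul_eq hc]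
  match_scalars <;> ring

theorem anti_add_lie_swap (h : IsLoopSystem q M D a b α β) {N : ℤ}
    (hN : ∀ m n, m + n ≤ N → a m * a n = a n * a m) {m n : ℤ} (hmn : m + n ≤ N) :
    θ q • (a m * b (n + 1) + b (n + 1) * a m) + (β m * a (n + 1) - a (n + 1) * β m)
      = θ q • (a n * b (m + 1) + b (m + 1) * a n) + (β n * a (m + 1) - a (m + 1) * β n) := by
  have e1 := h.anti_swap (hN m n hmn)
  have e2 := h.lie_beta (m - 1) (n + 1)
  have e3 := h.lie_beta (n - 1) (m + 1)
  have e4 := h.lie_symm hN (m + n).toNat (n + 1) (m - 1) (by omega) (by omega)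
  have e5 := h.lie_symm hN (m + n).toNat (m + 1) (n - 1) (by omega) (by omega)
  have e6 := h.lie_succ (hN (m - 1) n (by omega))
  have e7 := h.lie_succ (hN (n - 1) m (by omega))
  have e8 := h.lie_symm hN (m + n).toNat (m - 1) (n - 1) (by omega) (by omega)
  rw [sub_add_cancel] at e2 e3
  rw [e2, e3, e4, e5, e6, e7, e8]
  linear_combination (norm := skip) θ q • e1
  simp only [iterLie, expand_rules]
  match_scalars <;> ring

theorem lie_alpha_swap (h : IsLoopSystem q M D a b α β) (hq : q + q⁻¹ ≠ 0) {N : ℤ}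
    (hN : ∀ m n, m + n ≤ N → a m * a n = a n * a m) {m n : ℤ} (hm : 1 ≤ m) (hn : 1 ≤ n)
    (hmn : m + n ≤ N) :
    α m * α (n + 1) - α (n + 1) * α m = α n * α (m + 1) - α (m + 1) * α n := by
  have key : ∀ m n : ℤ, m + n ≤ N → _ := fun m n hmn =>
    anti_symm_comm_aux (q := q) (h.lie_m m) (h.lie_m (n + 1)) (h.anti_b m) (h.anti_b (n + 1))
      (h.beta_succ m) (h.beta_succ (n + 1)) (h.anti_beta m) (h.anti_beta (n + 1))
      (h.comm_alpha m) (h.comm_alpha (n + 1))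
      (lie_sub_lie_aux (h.lie_m m) (h.lie_m (n + 1)) (h.anti_b m) (h.anti_b (n + 1))
        (h.beta_succ m) (h.beta_succ (n + 1))
        (h.lie_symm hN (m + n + 1).toNat m (n + 1) (by omega) (by omega))) rfl
  have e1 := key m n hmn
  have e2 := key n m (by omega)
  rw [h.symm_comm m n hm hn, e2, h.anti_add_lie_swap hN hmn] at e1
  have : (q + q⁻¹) • (α m * α (n + 1) - α (n + 1) * α m
      - (α n * α (m + 1) - α (m + 1) * α n)) = 0 := by
    linear_combination (norm := skip) (1 / 2 : ℂ) • e1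
    simp only [expand_rules]
    match_scalars <;> ring
  exact sub_eq_zero.1 ((smul_eq_zero.1 this).resolve_left hq)

theorem comm_alpha_of_le (h : IsLoopSystem q M D a b α β) (hq : q + q⁻¹ ≠ 0) {N : ℤ}
    (hN : ∀ m n, m + n ≤ N → a m * a n = a n * a m) (k : ℕ) :
    ∀ m : ℤ, 1 ≤ m → m + k ≤ N → α m * α (k + 1) = α (k + 1) * α m := by
  induction k with
  | zero =>
    intro m _ _
    rw [Nat.cast_zero, zero_add]
    exact (h.alpha_one m).symm
  | succ k ih =>
    intro m hm hmk
    push_cast at hmk ⊢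
    have e := h.lie_alpha_swap hq hN hm (n := k + 1) (by omega) (by omega)
    rw [ih (m + 1) (by omega) (by omega), sub_self] at e
    exact sub_eq_zero.1 e

theorem commute_of_le (h : IsLoopSystem q M D a b α β) (hq : q + q⁻¹ ≠ 0) (k : ℕ) :
    ∀ m n : ℤ, m + n ≤ k → a m * a n = a n * a m := by
  have key : ∀ m n : ℤ, m ≤ 0 → a m * a n = a n * a m := by
    intro m n hm
    rcases hm.lt_or_eq with hm | rfl
    · rw [h.a_neg m hm, zero_mul, mul_zero]
    · rw [h.a_zero, smul_one_mul, mul_smul_one]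
  induction k with
  | zero =>
    intro m n hmn
    rcases (by push_cast at hmn; omega : m ≤ 0 ∨ n ≤ 0) with hm | hn
    · exact key m n hm
    · exact (key n m hn).symm
  | succ k ih =>
    intro m n hmn
    push_cast at hmn
    rcases le_or_gt m 0 with hm | hm
    · exact key m n hm
    rcases le_or_gt n 0 with hn | hn
    · exact (key n m hn).symm
    have e := h.lie_a_eq_lie_alpha hq ih hm hn hmn
    have e' := h.comm_alpha_of_le hq ih (n - 1).toNat m hm (by omega)
    rw [show (((n - 1).toNat : ℕ) : ℤ) + 1 = n by omega] at e'
    rw [e', sub_self] at e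
    exact sub_eq_zero.1 e

theorem commute (h : IsLoopSystem q M D a b α β) (hq : q + q⁻¹ ≠ 0) (m n : ℤ) :
    a m * a n = a n * a m :=
  h.commute_of_le hq (m + n).toNat m n (by omega)

end IsLoopSystem

namespace IsRootSystem

variable {A : Type*} [Ring A] [Algebra ℂ A] {q : ℂ} {M : A} {Xo Xe Yo Ye : ℕ → A}

section Brackets

variable (h : IsRootSystem q M Xo Xe Yo Ye) (hq : q ≠ 0)
  (hs : ∀ n, M * M * sOdd q Xo Yo n = sOdd q Xo Yo n * (M * M))
  (hp : ∀ n, M * M * pEven q Xo Ye n = pEven q Xo Ye n * (M * M))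
  (hs' : ∀ n, M * M * sOdd' q M Xe Ye n = sOdd' q M Xe Ye n * (M * M))
  (hp' : ∀ n, M * M * pEven' q Xe Yo n = pEven' q Xe Yo n * (M * M))

include h hq

theorem lie_xo_s' (n : ℕ) :
    Xo 0 * sOdd' q M Xe Ye (n + 2) = sOdd' q M Xe Ye (n + 2) * Xo 0
      + (q • (Xe 0 * pEven q Xo Ye (n + 1)) - q⁻¹ • (pEven q Xo Ye (n + 1) * Xe 0)) := by
  have := lie_xo_prime_aux (y := Ye n) hq 1 h.serre_x
  rw [one_mul, sub_eq_iff_eq_add'] at this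
  exact this

theorem lie_xo_p' (n : ℕ) :
    Xo 0 * pEven' q Xe Yo (n + 1) = pEven' q Xe Yo (n + 1) * Xo 0
      + (q • (Xe 0 * sOdd q Xo Yo (n + 1)) + q⁻¹ • (sOdd q Xo Yo (n + 1) * Xe 0)) := by
  have := lie_xo_prime_aux (y := Yo n) hq (-1) h.serre_x
  rw [sub_eq_iff_eq_add', neg_one_mul, neg_smul, sub_neg_eq_add, neg_smul, sub_neg_eq_add] at this
  exact this

include hs hp in
theorem lie_p_yo (n j : ℕ) :
    pEven q Xo Ye (n + 1) * Yo j = Yo j * pEven q Xo Ye (n + 1)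
      + (q • (sOdd q Xo Yo (n + 1) * Ye j) - q⁻¹ • (Ye j * sOdd q Xo Yo (n + 1))) := by
  have e1 := bracket_eq_of_shift (f := fun j => pEven q Xo Ye (j + 1)) h.xo_succ h.ye_succ
    (fun _ => rfl) (fun j => hp _) n 0
  have e2 := bracket_eq_of_shift (f := fun j => sOdd q Xo Yo (j + 1)) h.xo_succ h.yo_succ
    (fun _ => rfl) (fun j => hs _) n 0
  have e3 := bracket_serre_y_aux (x := Xo n) hq (-1) h.serre_y
  rw [neg_one_mul, neg_smul q⁻¹ (Yo 0 * Xo n), ← sub_eq_add_neg, e1, e2] at e3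
  have e4 := lie_shift_of_comm h.yo_succ h.ye_succ (hp _) (hs _) e3 j
  rw [neg_one_smul, ← sub_eq_add_neg, sub_eq_iff_eq_add', neg_smul, ← sub_eq_add_neg] at e4
  exact e4

include hs' hp' in
theorem anti_s'_yo (n j : ℕ) :
    sOdd' q M Xe Ye (n + 2) * Yo j + Yo j * sOdd' q M Xe Ye (n + 2)
      = q • (pEven' q Xe Yo (n + 1) * Ye j) - q⁻¹ • (Ye j * pEven' q Xe Yo (n + 1)) := by
  have e1 := bracket_eq_of_shift (f := fun j => sOdd' q M Xe Ye (j + 2)) h.xe_succ h.ye_succ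
    (fun _ => rfl) (fun j => hs' _) n 0
  have e2 := bracket_eq_of_shift (c := -q⁻¹) (f := fun j => pEven' q Xe Yo (j + 1))
    h.xe_succ h.yo_succ (fun _ => by rw [neg_smul, sub_neg_eq_add]; rfl) (fun j => hp' _) n 0
  rw [neg_smul, sub_neg_eq_add] at e2
  have e3 := bracket_serre_y_aux (x := Xe n) hq 1 h.serre_y
  rw [one_mul, e1, e2] at e3
  have e4 := lie_shift_of_comm h.yo_succ h.ye_succ (hs' _) (hp' _) e3 j
  rw [one_smul, neg_smul, ← sub_eq_add_neg] at e4
  exact e4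

include hs hp hs' hp'

theorem symm_anti (m n : ℕ) :
    sOdd q Xo Yo (m + 1) * sOdd' q M Xe Ye (n + 2) + sOdd' q M Xe Ye (n + 2) * sOdd q Xo Yo (m + 1)
        - q • (pEven' q Xe Yo (n + 1) * pEven q Xo Ye (m + 1))
        + q⁻¹ • (pEven q Xo Ye (m + 1) * pEven' q Xe Yo (n + 1))
      = sOdd q Xo Yo (n + 1) * sOdd' q M Xe Ye (m + 2)
        + sOdd' q M Xe Ye (m + 2) * sOdd q Xo Yo (n + 1)
        - q • (pEven' q Xe Yo (m + 1) * pEven q Xo Ye (n + 1))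
        + q⁻¹ • (pEven q Xo Ye (n + 1) * pEven' q Xe Yo (m + 1)) :=
  symm_anti_aux (y := Yo m) (w := Ye m) hq (h.lie_xo_s' hq n) (h.lie_xo_p' hq n)
    (by rw [← h.anti_s'_yo hq hs' hp']; abel) (h.lie_p_yo hq hs hp n m)

theorem symm_comm (hm_p' : ∀ n, M * pEven' q Xe Yo n - pEven' q Xe Yo n * M
      = sOdd q Xo Yo (n + 1) - sOdd' q M Xe Ye (n + 1))
    (hm_s' : ∀ n, M * sOdd' q M Xe Ye n + sOdd' q M Xe Ye n * M
      = pEven q Xo Ye n - pEven' q Xe Yo n) (m n : ℕ) :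
    sOdd q Xo Yo (m + 1) * pEven' q Xe Yo (n + 2) - pEven' q Xe Yo (n + 2) * sOdd q Xo Yo (m + 1)
        + q • (pEven' q Xe Yo (m + 1) * sOdd q Xo Yo (n + 2))
        - q⁻¹ • (sOdd q Xo Yo (n + 2) * pEven' q Xe Yo (m + 1))
        + (q - 1) • (sOdd' q M Xe Ye (n + 2) * pEven q Xo Ye (m + 1))
        + (1 - q⁻¹) • (pEven q Xo Ye (m + 1) * sOdd' q M Xe Ye (n + 2))
      = sOdd q Xo Yo (n + 1) * pEven' q Xe Yo (m + 2)
        - pEven' q Xe Yo (m + 2) * sOdd q Xo Yo (n + 1)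
        + q • (pEven' q Xe Yo (n + 1) * sOdd q Xo Yo (m + 2))
        - q⁻¹ • (sOdd q Xo Yo (m + 2) * pEven' q Xe Yo (n + 1))
        + (q - 1) • (sOdd' q M Xe Ye (m + 2) * pEven q Xo Ye (n + 1))
        + (1 - q⁻¹) • (pEven q Xo Ye (n + 1) * sOdd' q M Xe Ye (m + 2)) := by
  have e1 := h.m_comm_p (n + 1)
  have e2 := h.m_anti_s (n + 1)
  have e3 := hm_p' (n + 1)
  have e4 := hm_s' (n + 2)
  rw [sub_eq_iff_eq_add'] at e1 e3
  rw [← eq_sub_iff_add_eq] at e2 e4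
  rw [← add_sub_assoc] at e1 e3
  have hy1 := anti_y_aux (h.ye m) (h.yo m) e1 e2 (h.lie_p_yo hq hs hp n m)
    (h.anti_s'_yo hq hs' hp' n m)
  have hy2 := comm_y_aux (h.ye m) (h.yo m) e3 e4 (h.lie_p_yo hq hs hp (n + 1) m)
    (h.anti_s'_yo hq hs' hp' n m)
  exact symm_comm_aux hq (h.lie_xo_s' hq n) (h.lie_xo_p' hq n) (h.lie_xo_p' hq (n + 1))
    (by rw [← hy1]; abel) hy2

end Brackets

end IsRootSystem

namespace IsCurrentSystem

variable {A : Type*} [Ring A] [Algebra ℂ A] {q : ℂ} {M : A} {s p s' p' : ℕ → A}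

theorem average_neg_natCast (p p' : ℕ → A) (m : ℕ) :
    average p (-p') m = (2 : ℂ)⁻¹ • (p m - p' m) := by
  rw [average_natCast, Pi.neg_apply, sub_eq_add_neg]

theorem average_add_average_neg (p p' : ℕ → A) (m : ℕ) :
    average p p' m + average p (-p') m = p m := by
  rw [average_natCast, average_neg_natCast]; module

theorem average_sub_average_neg (p p' : ℕ → A) (m : ℕ) :
    average p p' m - average p (-p') m = p' m := by
  rw [average_natCast, average_neg_natCast]; module

theorem isLoopSystem (h : IsCurrentSystem q M s p s' p') (hq : q ≠ 0)
    (hr : ∀ n : ℕ, n ≠ 0 → q ^ n ≠ 1) (h1 : p' 1 = p 1 - (2 : ℂ) • (M * M))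
    (symm_anti : ∀ m n,
      s (m + 1) * s' (n + 2) + s' (n + 2) * s (m + 1)
          - q • (p' (n + 1) * p (m + 1)) + q⁻¹ • (p (m + 1) * p' (n + 1))
        = s (n + 1) * s' (m + 2) + s' (m + 2) * s (n + 1)
          - q • (p' (m + 1) * p (n + 1)) + q⁻¹ • (p (n + 1) * p' (m + 1)))
    (symm_comm : ∀ m n,
      s (m + 1) * p' (n + 2) - p' (n + 2) * s (m + 1)
          + q • (p' (m + 1) * s (n + 2)) - q⁻¹ • (s (n + 2) * p' (m + 1))
          + (q - 1) • (s' (n + 2) * p (m + 1)) + (1 - q⁻¹) • (p (m + 1) * s' (n + 2))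
        = s (n + 1) * p' (m + 2) - p' (m + 2) * s (n + 1)
          + q • (p' (n + 1) * s (m + 2)) - q⁻¹ • (s (m + 2) * p' (n + 1))
          + (q - 1) • (s' (m + 2) * p (n + 1)) + (1 - q⁻¹) • (p (n + 1) * s' (m + 2))) :
    IsLoopSystem q M (p 1) (average p p') (average s s') (average p (-p')) (average s (-s')) := by
  have hc := h.commUpTo hq hr
  have hθ : θ q ≠ 0 := by simpa [θ] using pow_sub_inv_pow_ne_zero hq hr 1 one_ne_zero
  have hp : ∀ n, M * M * p n = p n * (M * M) := fun n => (hc (n + 1)).comm_p n n.lt_succ_self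
  have hp' : ∀ n, M * M * p' n = p' n * (M * M) := fun n => by
    have := (hc n).lie_p' h n le_rfl
    rw [hp, sub_self] at this
    exact sub_eq_zero.1 this
  have tower := fun n => (hc n).isTower h hθ
  refine ⟨CommUpTo.average_zero h, fun m hm => average_of_neg _ _ hm, ?_, fun m => ?_, fun m => ?_,
    fun m => ?_, fun m => ?_, fun m => ?_, fun m => ?_, fun m => ?_, fun m k => ?_, fun m => ?_,
    fun m n hm hn => ?_, fun m n hm hn => ?_⟩
  · intro m hm
    rcases hm.lt_or_eq with hm | rfl
    · exact average_of_neg _ _ hm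
    · rw [← Nat.cast_zero, average_natCast, h.s_zero, h.s'_zero, add_zero, smul_zero]
  · rw [← (hc m.toNat).average_m h hθ m (by omega)]; abel
  · exact (hc (m + 1).toNat).lie_average h m (by omega)
  · exact (hc m.toNat).average_s_succ h hθ m (by omega)
  · rcases lt_or_ge m 0 with hm | hm
    · simp [average_of_neg _ _ hm]
    · lift m to ℕ using hm
      have e1 := h.m_anti_s m
      have e2 := (hc m).m_anti_s' h m le_rfl
      rw [average_natCast, average_neg_natCast]
      linear_combination (norm := skip) (2 : ℂ)⁻¹ • (e1 + e2)
      simp only [expand_rules]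
      match_scalars <;> ring
  · rcases lt_or_ge m 0 with hm | hm
    · rw [average_of_neg _ _ hm]
      rcases (by omega : m + 1 < 0 ∨ m + 1 = 0) with hm' | hm'
      · simp [average_of_neg _ _ hm']
      · rw [hm', ← Nat.cast_zero, average_neg_natCast, h.s_zero, h.s'_zero]; simp
    · lift m to ℕ using hm
      rw [← Nat.cast_succ, average_neg_natCast, average_natCast, (hc m).sub_succ h hθ m le_rfl]
      module
  · rcases lt_or_ge m 0 with hm | hm
    · simp [average_of_neg _ _ hm]
    · lift m to ℕ using hm
      have e1 := h.m_anti_s m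
      have e2 := (hc m).m_anti_s' h m le_rfl
      rw [average_neg_natCast]
      linear_combination (norm := skip) (2 : ℂ)⁻¹ • (e1 - e2)
      simp only [expand_rules]
      match_scalars <;> ring
  · rcases lt_or_ge m 0 with hm | hm
    · simp [average_of_neg _ _ hm]
    · lift m to ℕ using hm
      have e1 := h.m_comm_p m
      have e2 := (hc m).m_comm_p' h m le_rfl
      rw [average_neg_natCast]
      linear_combination (norm := skip) (2 : ℂ)⁻¹ • (e1 - e2)
      simp only [expand_rules]
      match_scalars <;> ring
  · rcases lt_or_ge m 0 with hm | hm
    · simp [average_of_neg _ _ hm]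
    · lift m to ℕ using hm
      rcases Nat.even_or_odd' m with ⟨l, rfl | rfl⟩
      · exact sub_eq_zero.1 ((tower (2 * l + 2 * k)).lie_sq_even l k le_rfl)
      · have e := (tower (2 * (k + l) + 2)).lie_sq_odd hq hθ (k + l) (by omega) l k rfl
          (by omega)
        rw [(tower (2 * (k + l) + 2)).anti (k + l) (by omega), smul_zero] at e
        refine sub_eq_zero.1 ((smul_eq_zero.1 e).resolve_left ?_)
        exact mul_ne_zero (pow_ne_zero _ (by norm_num)) hθ
  · rcases lt_or_ge m 0 with hm | hm
    · simp [average_of_neg _ _ hm]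
    · lift m to ℕ using hm
      have e1 := hp m
      have e2 := hp' m
      rw [← Nat.cast_one, average_neg_natCast, average_neg_natCast, h1]
      linear_combination (norm := skip) (2 : ℂ)⁻¹ • (e1 - e2)
      simp only [expand_rules]
      match_scalars <;> ring
  all_goals
    obtain ⟨m, rfl⟩ : ∃ k : ℕ, m = ((k + 1 : ℕ) : ℤ) := ⟨(m - 1).toNat, by omega⟩
    obtain ⟨n, rfl⟩ : ∃ k : ℕ, n = ((k + 1 : ℕ) : ℤ) := ⟨(n - 1).toNat, by omega⟩
    rw [← Nat.cast_succ, ← Nat.cast_succ]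
    simp only [average_add_average_neg, average_sub_average_neg]
  · exact symm_anti m n
  · exact symm_comm m n

end IsCurrentSystem

namespace IsRootSystem

variable {A : Type*} [Ring A] [Algebra ℂ A] {q : ℂ} {M : A} {Xo Xe Yo Ye : ℕ → A}

theorem isLoopSystem (h : IsRootSystem q M Xo Xe Yo Ye) (hq : q ≠ 0)
    (hr : ∀ n : ℕ, n ≠ 0 → q ^ n ≠ 1) :
    IsLoopSystem q M (pEven q Xo Ye 1) (average (pEven q Xo Ye) (pEven' q Xe Yo))
      (average (sOdd q Xo Yo) (sOdd' q M Xe Ye)) (average (pEven q Xo Ye) (-pEven' q Xe Yo))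
      (average (sOdd q Xo Yo) (-sOdd' q M Xe Ye)) := by
  have hθ : θ q ≠ 0 := by simpa [θ] using pow_sub_inv_pow_ne_zero hq hr 1 one_ne_zero
  have hq3 : 1 + q + q⁻¹ ≠ 0 := fun h0 => hr 3 (by norm_num) <| by
    field_simp at h0
    linear_combination (q - 1) * h0
  have hq6 : 1 - q - q⁻¹ ≠ 0 := fun h0 => hr 6 (by norm_num) <| by
    field_simp at h0
    linear_combination -(q + 1) * (q ^ 3 - 1) * h0
  have hq4 : q + q⁻¹ ≠ 0 := fun h0 => hr 4 (by norm_num) <| by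
    field_simp at h0
    linear_combination (q ^ 2 - 1) * h0
  have hc := h.isCurrentSystem hq hq3 hq6 hq4 hθ
  have hu := hc.commUpTo hq hr
  have hp := fun n => (hu (n + 1)).comm_p n n.lt_succ_self
  have hs := fun n => (hu n).comm_s n le_rfl
  have hs' := fun n => (hu n).comm_s' hc n le_rfl
  have hp' : ∀ n, M * M * pEven' q Xe Yo n = pEven' q Xe Yo n * (M * M) := fun n => by
    have := (hu n).lie_p' hc n le_rfl
    rw [hp, sub_self] at this
    exact sub_eq_zero.1 this
  exact hc.isLoopSystem hq hr h.p_one_sub (h.symm_anti hq hs hp hs' hp')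
    (h.symm_comm hq hs hp hs' hp' (fun n => (hu n).m_comm_p' hc n le_rfl)
      fun n => (hu n).m_anti_s' hc n le_rfl)

end IsRootSystem

theorem IsLoopSystem.a_mul_iterLie_eq {A : Type*} [Ring A] [Algebra ℂ A] {q : ℂ} {M D : A}
    {a b α β : ℤ → A} (h : IsLoopSystem q M D a b α β) (m : ℤ) (k : ℕ) :
    a m * iterLie D M k = iterLie D M k * a m
      + (θ q / 2) • (a (m - 1) * iterLie D M (k + 1) + iterLie D M (k + 1) * a (m - 1))
      + (1 / 4 : ℂ) • (a (m - 2) * iterLie D M (k + 2) - iterLie D M (k + 2) * a (m - 2)) := by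
  have e := h.iterLie_b_succ (m - 1) (k + 1)
  rw [sub_add_cancel, sub_sub, one_add_one_eq_two] at e
  rw [h.a_mul_iterLie m k, e, h.a_mul_iterLie (m - 2) (k + 2), add_sub_cancel_left]
  simp only [add_assoc]

theorem sub_neg_smul {A : Type*} [Ring A] [Algebra ℂ A] (c : ℂ) (x y : A) :
    x - (-c) • y = x + c • y := by
  rw [neg_smul, sub_neg_eq_add]

theorem sub_neg_one_smul {A : Type*} [Ring A] [Algebra ℂ A] (x y : A) :
    x - (-1 : ℂ) • y = x + y := by
  rw [neg_one_smul, sub_neg_eq_add]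

theorem smul_symm_add_smul_anti {A : Type*} [Ring A] [Algebra ℂ A] {t : ℂ} (ht : t ≠ 0)
    (x y : A) :
    (t / 2) • (t⁻¹ • 1 * x + x * t⁻¹ • 1) + (1 / 4 : ℂ) • (0 * y - y * 0) = x := by
  rw [zero_mul, mul_zero, sub_zero, smul_zero, add_zero, smul_one_mul, mul_smul_one, ← two_smul ℂ,
    smul_smul, smul_smul]
  convert one_smul ℂ x using 2
  field_simp

section RootVectors

variable (q : ℂ)

theorem isRootSystem : IsRootSystem q (L1U q) (fun i => X q (2 * i + 1)) (fun i => X q (2 * i + 2))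
    (fun i => Y q (2 * i + 1)) (fun i => Y q (2 * i + 2)) where
  xe i := by
    have : X q (2 * i + 2) = X q (2 * i + 1) * L1U q
      - ((-1 : ℂ) ^ (2 * i)) • (L1U q * X q (2 * i + 1)) := rfl
    rw [this, pow_mul, neg_one_sq, one_pow, one_smul]
  xo i := by
    have : X q (2 * (i + 1) + 1) = X q (2 * i + 2) * L1U q
      - ((-1 : ℂ) ^ (2 * i + 1)) • (L1U q * X q (2 * i + 2)) := rfl
    rw [this, pow_succ, pow_mul, neg_one_sq, one_pow, one_mul]
    exact sub_neg_one_smul _ _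
  ye i := by
    have : Y q (2 * i + 2) = L1U q * Y q (2 * i + 1)
      - ((-1 : ℂ) ^ (2 * i + 1)) • (Y q (2 * i + 1) * L1U q) := rfl
    rw [this, pow_succ, pow_mul, neg_one_sq, one_pow, one_mul]
    exact sub_neg_one_smul _ _
  yo i := by
    have : Y q (2 * (i + 1) + 1) = L1U q * Y q (2 * i + 2)
      - ((-1 : ℂ) ^ (2 * (i + 1))) • (Y q (2 * i + 2) * L1U q) := rfl
    rw [this, pow_mul, neg_one_sq, one_pow, one_smul]
  m := rfl
  serre_x := by
    have h : π q (serre1 q) = π q 0 := RingQuot.mkAlgHom_rel ℂ Rel.one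
    simp only [serre1, X2F, L1F, map_sub, map_mul, map_smul, map_zero] at h
    simpa [X, L1U] using sub_eq_zero.1 h
  serre_y := by
    have h : π q (serre2 q) = π q 0 := RingQuot.mkAlgHom_rel ℂ Rel.two
    simp only [serre2, Y2F, L1F, map_sub, map_add, map_mul, map_smul, map_zero] at h
    have e : Y q 2 = L1U q * Y q 1 + Y q 1 * L1U q := by
      have : Y q 2 = L1U q * Y q 1 - ((-1 : ℂ) ^ 1) • (Y q 1 * L1U q) := rfl
      rw [this, pow_one]
      exact sub_neg_one_smul _ _
    change Y q 2 * π q x2 = q • (π q x2 * Y q 2)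
    rw [e]
    exact sub_eq_zero.1 h

theorem pEven_eq_L (n : ℕ) :
    pEven q (fun i => X q (2 * i + 1)) (fun i => Y q (2 * i + 2)) n = L q (2 * n) := by
  cases n <;> rfl

theorem pEven'_eq_L' (n : ℕ) :
    pEven' q (fun i => X q (2 * i + 2)) (fun i => Y q (2 * i + 1)) n = L' q (2 * n) := by
  cases n with
  | zero => rfl
  | succ n =>
    have : L' q (2 * (n + 1)) = X q 2 * Y q (2 * n + 1)
      - ((-1 : ℂ) ^ (2 * n + 1) * q⁻¹) • (Y q (2 * n + 1) * X q 2) := rfl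
    rw [this, pow_succ, pow_mul, neg_one_sq, one_pow, one_mul, neg_one_mul]
    exact (sub_neg_smul q⁻¹ _ _).symm

theorem average_eq_Lt (n : ℕ) :
    average (pEven q (fun i => X q (2 * i + 1)) (fun i => Y q (2 * i + 2)))
      (pEven' q (fun i => X q (2 * i + 2)) (fun i => Y q (2 * i + 1))) n = Lt q (2 * (n : ℤ)) := by
  rw [average_natCast, pEven_eq_L, pEven'_eq_L', Lt, if_pos (by positivity)]
  rfl

theorem iterLie_eq_M (k : ℕ) :
    iterLie (pEven q (fun i => X q (2 * i + 1)) (fun i => Y q (2 * i + 2)) 1) (L1U q) k = M q k := by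
  induction k with
  | zero => rfl
  | succ k ih => rw [iterLie_succ, ih, pEven_eq_L]; rfl

variable {q}

theorem Lt_comm (hq0 : q ≠ 0) (hq : NotRootOfUnity q) (m n : ℕ) :
    Lt q (2 * (m : ℤ)) * Lt q (2 * (n : ℤ)) = Lt q (2 * (n : ℤ)) * Lt q (2 * (m : ℤ)) := by
  have hq4 : q + q⁻¹ ≠ 0 := fun h0 => hq 4 (by norm_num) <| by
    field_simp at h0
    linear_combination (q ^ 2 - 1) * h0
  have := ((isRootSystem q).isLoopSystem hq0 hq).commute hq4 m n
  simpa only [average_eq_Lt] using this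

theorem Lt_zero : Lt q 0 = (θ q)⁻¹ • 1 := by
  simp only [Lt, le_refl, if_true, Int.toNat_zero, L, L']
  module

theorem Lt_two_mul_M (hq0 : q ≠ 0) (hq : NotRootOfUnity q) (n k : ℕ) :
    Lt q (2 * ((n + 2 : ℕ) : ℤ)) * M q k = M q k * Lt q (2 * ((n + 2 : ℕ) : ℤ))
      + (θ q / 2) • (Lt q (2 * ((n + 1 : ℕ) : ℤ)) * M q (k + 1)
        + M q (k + 1) * Lt q (2 * ((n + 1 : ℕ) : ℤ)))
      + (1 / 4 : ℂ) • (Lt q (2 * (n : ℤ)) * M q (k + 2) - M q (k + 2) * Lt q (2 * (n : ℤ))) := by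
  have := ((isRootSystem q).isLoopSystem hq0 hq).a_mul_iterLie_eq (n + 2 : ℕ) k
  rw [show ((n + 2 : ℕ) : ℤ) - 1 = (n + 1 : ℕ) by push_cast; ring,
    show ((n + 2 : ℕ) : ℤ) - 2 = n by push_cast; ring] at this
  simpa only [average_eq_Lt, iterLie_eq_M] using this

theorem Lt_two_mul_M' (hq0 : q ≠ 0) (hq : NotRootOfUnity q) (k : ℕ) :
    Lt q (2 * ((1 : ℕ) : ℤ)) * M q k = M q k * Lt q (2 * ((1 : ℕ) : ℤ)) + M q (k + 1) := by
  have h := (isRootSystem q).isLoopSystem hq0 hq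
  have hθ : θ q ≠ 0 := by simpa [θ] using pow_sub_inv_pow_ne_zero hq0 hq 1 one_ne_zero
  have := h.a_mul_iterLie_eq (1 : ℕ) k
  have a1 := average_eq_Lt q 1
  have a0 := average_eq_Lt q 0
  rw [Nat.cast_zero, mul_zero, Lt_zero] at a0
  simp only [Nat.cast_one] at this a1 ⊢
  rw [sub_self, h.a_neg (1 - 2) (by norm_num), a1, a0] at this
  simp only [iterLie_eq_M] at this
  rw [this, add_assoc, smul_symm_add_smul_anti hθ]

end RootVectors

end QAff

namespace QAff

open Finset

theorem sum_composition_succ {B : Type*} [AddCommMonoid B] (n : ℕ) (f : List ℕ → B) :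
    ∑ c : Composition (n + 1), f c.blocks =
      ∑ p ∈ antidiagonal n, ∑ c : Composition p.2, f ((p.1 + 1) :: c.blocks) := by
  rw [Finset.sum_sigma']
  symm
  refine Finset.sum_bij (fun x hx => ⟨(x.1.1 + 1) :: x.2.blocks, ?_, ?_⟩) ?_ ?_ ?_ ?_
  · rintro i hi
    rcases List.mem_cons.1 hi with rfl | hi
    · exact Nat.succ_pos _
    · exact x.2.blocks_pos hi
  · have := HasAntidiagonal.mem_antidiagonal.1 (Finset.mem_sigma.1 hx).1
    rw [List.sum_cons, x.2.blocks_sum]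
    omega
  · exact fun _ _ => Finset.mem_univ _
  · rintro ⟨⟨i, j⟩, c⟩ hc ⟨⟨i', j'⟩, c'⟩ hc' h
    have h1 := HasAntidiagonal.mem_antidiagonal.1 (Finset.mem_sigma.1 hc).1
    have h2 := HasAntidiagonal.mem_antidiagonal.1 (Finset.mem_sigma.1 hc').1
    simp only [Composition.mk.injEq, List.cons.injEq, add_left_inj] at h h1 h2
    obtain ⟨rfl, h⟩ := h
    obtain rfl : j = j' := by omega
    obtain rfl : c = c' := Composition.ext h
    rfl
  · rintro ⟨l, hl, hs⟩ -
    cases l with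
    | nil => simp at hs
    | cons i l =>
      have hi : 0 < i := hl List.mem_cons_self
      rw [List.sum_cons] at hs
      refine ⟨⟨(i - 1, l.sum), l, fun h => hl (List.mem_cons_of_mem _ h), rfl⟩, ?_, ?_⟩
      · simp only [mem_sigma, HasAntidiagonal.mem_antidiagonal, mem_univ, and_true]
        omega
      · simp only [Composition.mk.injEq, List.cons.injEq, and_true]
        omega
  · exact fun _ _ => rfl

section CompSum

variable {A : Type*} [Ring A] [Algebra ℂ A]

/-- The coefficient of degree `n` of the composition of the power series with coefficients `w`
with the power series with coefficients `l` and zero constant term. -/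
def compSum (l : ℕ → A) (w : ℕ → ℂ) (n : ℕ) : A :=
  ∑ c : Composition n, w c.length • (c.blocks.map l).prod

theorem compSum_zero (l : ℕ → A) (w : ℕ → ℂ) : compSum l w 0 = w 0 • 1 := by
  have h : ∀ c : Composition 0, c.blocks = [] := fun c =>
    List.eq_nil_iff_forall_not_mem.2 fun i hi => by
      have := c.blocks_pos hi
      have := List.le_sum_of_mem hi
      rw [c.blocks_sum] at this
      omega
  have hs : Subsingleton (Composition 0) := ⟨fun c d => Composition.ext ((h c).trans (h d).symm)⟩
  rw [compSum, Fintype.sum_subsingleton _ (Composition.ones 0), Composition.length, h]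
  simp

theorem compSum_succ (l : ℕ → A) (w : ℕ → ℂ) (n : ℕ) :
    compSum l w (n + 1) =
      ∑ p ∈ antidiagonal n, l (p.1 + 1) * compSum l (fun k => w (k + 1)) p.2 := by
  refine (sum_composition_succ n fun b => w b.length • (b.map l).prod).trans ?_
  refine Finset.sum_congr rfl fun p _ => ?_
  rw [compSum, Finset.mul_sum]
  refine Finset.sum_congr rfl fun c _ => ?_
  rw [List.length_cons, List.map_cons, List.prod_cons, mul_smul_comm]

theorem compSum_smul (l : ℕ → A) (t : ℂ) (w : ℕ → ℂ) (n : ℕ) :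
    compSum l (fun k => t * w k) n = t • compSum l w n := by
  simp only [compSum, mul_smul, Finset.smul_sum]

theorem compSum_add (l : ℕ → A) (v w : ℕ → ℂ) (n : ℕ) :
    compSum l (fun k => v k + w k) n = compSum l v n + compSum l w n := by
  simp only [compSum, add_smul, Finset.sum_add_distrib]

theorem compSum_mem {S : Subalgebra ℂ A} {l : ℕ → A} (n : ℕ) (w : ℕ → ℂ)
    (hl : ∀ i, 1 ≤ i → i ≤ n → l i ∈ S) : compSum l w n ∈ S := by
  refine S.sum_mem fun c _ => S.smul_mem (S.list_prod_mem fun x hx => ?_) _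
  obtain ⟨i, hi, rfl⟩ := List.mem_map.1 hx
  refine hl i (c.blocks_pos hi) ?_
  exact (List.le_sum_of_mem hi).trans_eq c.blocks_sum

theorem mem_of_compSum_mem {S : Subalgebra ℂ A} {l : ℕ → A} {w : ℕ → ℂ} (hw : w 1 ≠ 0)
    (h : ∀ n, 1 ≤ n → compSum l w n ∈ S) (n : ℕ) (hn : 1 ≤ n) : l n ∈ S := by
  induction n using Nat.strong_induction_on with
  | _ n ih =>
    obtain ⟨n, rfl⟩ := Nat.exists_eq_add_of_le' hn
    have hs := h (n + 1) hn
    rw [compSum_succ, ← Finset.add_sum_erase _ _ (a := (n, 0)) (HasAntidiagonal.mem_antidiagonal.2 (by simp)),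
      compSum_zero] at hs
    have hr : ∑ p ∈ (antidiagonal n).erase (n, 0),
        l (p.1 + 1) * compSum l (fun k => w (k + 1)) p.2 ∈ S := by
      refine S.sum_mem fun p hp => ?_
      obtain ⟨hp0, hp⟩ := Finset.mem_erase.1 hp
      rw [HasAntidiagonal.mem_antidiagonal] at hp
      have : p.1 ≠ n := fun h => hp0 (Prod.ext h (by simp; omega))
      exact S.mul_mem (ih _ (by omega) (by omega))
        (compSum_mem _ _ fun i h1 h2 => ih i (by omega) h1)
    have := S.smul_mem (S.sub_mem hs hr) (w 1)⁻¹
    rwa [add_sub_cancel_right, mul_smul_comm, mul_one, zero_add, smul_smul, inv_mul_cancel₀ hw, one_smul] at this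

end CompSum

end QAff

namespace QAff

open Finset PowerSeries

section EulerOperator

variable {A : Type*} [Ring A]

/-- The Euler operator `X · d/dX` on power series. -/
def euler (f : A⟦X⟧) : A⟦X⟧ := PowerSeries.mk fun n => n • coeff n f

theorem coeff_euler (f : A⟦X⟧) (n : ℕ) : coeff n (euler f) = n • coeff n f := coeff_mk _ _

theorem euler_add (f g : A⟦X⟧) : euler (f + g) = euler f + euler g := by
  ext n
  simp only [coeff_euler, map_add, smul_add]

theorem euler_mul (f g : A⟦X⟧) : euler (f * g) = euler f * g + f * euler g := by
  ext n
  rw [coeff_euler, map_add, coeff_mul, coeff_mul, coeff_mul, Finset.smul_sum,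
    ← Finset.sum_add_distrib]
  refine Finset.sum_congr rfl fun p hp => ?_
  rw [coeff_euler, coeff_euler, smul_mul_assoc, mul_smul_comm, ← add_smul,
    HasAntidiagonal.mem_antidiagonal.1 hp]

theorem euler_C (a : A) : euler (C a) = 0 := by
  ext n
  rw [coeff_euler, coeff_C]
  split_ifs with h
  · simp [h]
  · simp

theorem commute_of_coeff {f g : A⟦X⟧} (h : ∀ m n, Commute (coeff m f) (coeff n g)) :
    f * g = g * f := by
  ext n
  rw [coeff_mul, coeff_mul, ← Finset.Nat.sum_antidiagonal_swap]
  exact Finset.sum_congr rfl fun p _ => (h p.2 p.1).eq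

theorem mul_right_cancel_of_constantCoeff_eq_one {f g e : A⟦X⟧} (he : constantCoeff e = 1)
    (h : f * e = g * e) : f = g := by
  have hu : e * invOfUnit e 1 = 1 := mul_invOfUnit e 1 (by simpa using he)
  rw [← mul_one f, ← hu, ← mul_assoc, h, mul_assoc, hu, mul_one]

end EulerOperator

section CompSeries

variable {A : Type*} [Ring A] [Algebra ℂ A]

theorem mk_compSum_eq {l : ℕ → A} (hl : l 0 = 0) (w : ℕ → ℂ) :
    PowerSeries.mk (compSum l w) =
      C (w 0 • 1) + PowerSeries.mk l * PowerSeries.mk (compSum l fun k => w (k + 1)) := by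
  ext n
  rw [map_add, coeff_mul, coeff_mk, coeff_C]
  cases n with
  | zero => simp [compSum_zero, hl]
  | succ n =>
    rw [compSum_succ, Finset.Nat.sum_antidiagonal_succ]
    simp [hl]

theorem euler_mk_compSum {l : ℕ → A} (hl : l 0 = 0) (hc : ∀ m n, Commute (l m) (l n))
    (w : ℕ → ℂ) :
    euler (PowerSeries.mk (compSum l w)) = euler (PowerSeries.mk l) *
      PowerSeries.mk (compSum l fun k => (k + 1 : ℂ) * w (k + 1)) := by
  have hcomm : PowerSeries.mk l * euler (PowerSeries.mk l)
      = euler (PowerSeries.mk l) * PowerSeries.mk l :=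
    commute_of_coeff fun m n => by
      rw [coeff_euler, coeff_mk, coeff_mk]
      exact (hc m n).smul_right n
  ext n
  induction n using Nat.strong_induction_on generalizing w with
  | _ n ih =>
    have h1 : coeff n (PowerSeries.mk l * euler (PowerSeries.mk (compSum l fun k => w (k + 1))))
        = coeff n (PowerSeries.mk l * (euler (PowerSeries.mk l) *
          PowerSeries.mk (compSum l fun k => (k + 1 : ℂ) * w (k + 1 + 1)))) := by
      rw [coeff_mul, coeff_mul]
      refine Finset.sum_congr rfl fun p hp => ?_
      rw [HasAntidiagonal.mem_antidiagonal] at hp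
      rcases Nat.eq_zero_or_pos p.1 with h0 | h0
      · rw [coeff_mk, h0, hl, zero_mul, zero_mul]
      · rw [ih p.2 (by omega)]
    have h2 := mk_compSum_eq hl fun k => (k : ℂ) * w (k + 1)
    simp only [Nat.cast_zero, zero_mul, zero_smul, map_zero, zero_add, Nat.cast_succ] at h2
    have h3 : PowerSeries.mk (compSum l fun k => (k + 1 : ℂ) * w (k + 1))
        = PowerSeries.mk (compSum l fun k => w (k + 1))
          + PowerSeries.mk (compSum l fun k => (k : ℂ) * w (k + 1)) := by
      ext n
      rw [map_add, coeff_mk, coeff_mk, coeff_mk, ← compSum_add]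
      congr 1
      ext k
      ring
    rw [mk_compSum_eq hl, euler_add, euler_C, zero_add, euler_mul, map_add, h1, ← map_add,
      ← mul_assoc, hcomm, mul_assoc, ← h2, ← mul_add, ← h3]

theorem euler_mk_compSum_exp {l : ℕ → A} (hl : l 0 = 0) (hc : ∀ m n, Commute (l m) (l n))
    (t : ℂ) :
    euler (PowerSeries.mk (compSum l fun k => t ^ k / (k.factorial : ℂ))) =
      PowerSeries.mk (fun n => (t * n) • l n) *
        PowerSeries.mk (compSum l fun k => t ^ k / (k.factorial : ℂ)) := by
  rw [euler_mk_compSum hl hc]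
  have : (fun k : ℕ => (k + 1 : ℂ) * (t ^ (k + 1) / ((k + 1).factorial : ℂ)))
      = fun k : ℕ => t * (t ^ k / (k.factorial : ℂ)) := by
    ext k
    have h1 : (k.factorial : ℂ) ≠ 0 := by exact_mod_cast k.factorial_ne_zero
    have h2 : (k + 1 : ℂ) ≠ 0 := by exact_mod_cast k.succ_ne_zero
    rw [Nat.factorial_succ]
    push_cast
    field_simp
    exact pow_succ' t k
  rw [this]
  ext n
  rw [coeff_mul, coeff_mul]
  refine Finset.sum_congr rfl fun p _ => ?_
  rw [coeff_euler, coeff_mk, coeff_mk, coeff_mk, coeff_mk, compSum_smul, mul_smul, smul_mul_assoc,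
    smul_mul_assoc, smul_mul_assoc, mul_smul_comm, Nat.cast_smul_eq_nsmul, smul_comm]

end CompSeries

end QAff

namespace QAff

open Finset PowerSeries

/-- The coefficients of `((1 + aX) (1 + bX)) / ((1 - aX) (1 - bX))`, read off its partial fraction
decomposition (for `a ≠ b`). -/
def pfCoeff (a b : ℂ) (n : ℕ) : ℂ :=
  if n = 0 then 1 else 2 * (a + b) / (a - b) * (a ^ n - b ^ n)

/-- The power sum of `a, b` minus the power sum of `-a, -b`. -/
def powerDiff (a b : ℂ) (n : ℕ) : ℂ := a ^ n + b ^ n - (-a) ^ n - (-b) ^ n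

theorem one_sub_mul_mk_pow (a : ℂ) : (1 - C a * PowerSeries.X) * PowerSeries.mk (fun n => a ^ n) = 1 := by
  ext n
  rw [sub_mul, one_mul, map_sub, mul_assoc, coeff_C_mul, coeff_mk, coeff_one]
  cases n with
  | zero => simp
  | succ n => rw [coeff_succ_X_mul, coeff_mk, pow_succ']; simp

theorem euler_mk_pow (a : ℂ) :
    (1 - C a * PowerSeries.X) * euler (PowerSeries.mk (fun n => a ^ n))
      = C a * PowerSeries.X * PowerSeries.mk (fun n => a ^ n) := by
  ext n
  rw [sub_mul, one_mul, map_sub, mul_assoc, mul_assoc, coeff_C_mul, coeff_C_mul, coeff_euler,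
    coeff_mk]
  cases n with
  | zero => simp
  | succ n =>
    rw [coeff_succ_X_mul, coeff_succ_X_mul, coeff_euler, coeff_mk, pow_succ']
    simp only [nsmul_eq_mul, Nat.cast_succ]
    ring

theorem mk_pfCoeff (a b : ℂ) : PowerSeries.mk (pfCoeff a b) =
    1 + C (2 * (a + b) / (a - b)) *
      (PowerSeries.mk (fun n => a ^ n) - PowerSeries.mk (fun n => b ^ n)) := by
  ext n
  rw [map_add, coeff_C_mul, map_sub, coeff_mk, coeff_mk, coeff_mk, coeff_one, pfCoeff]
  split_ifs with h
  · simp [h]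
  · rw [zero_add]

theorem mk_powerDiff (a b : ℂ) : PowerSeries.mk (powerDiff a b) =
    PowerSeries.mk (fun n => a ^ n) + PowerSeries.mk (fun n => b ^ n)
      - PowerSeries.mk (fun n => (-a) ^ n) - PowerSeries.mk (fun n => (-b) ^ n) := rfl

theorem partial_fraction_identity {K : Type*} [Field K] {u v c fa fb fa' fb' ea eb : K}
    (hc : c * (u - v) = (u + v) + (u + v))
    (ha : (1 - u) * fa = 1) (hb : (1 - v) * fb = 1)
    (ha' : (1 + u) * fa' = 1) (hb' : (1 + v) * fb' = 1)
    (hea : (1 - u) * ea = u * fa) (heb : (1 - v) * eb = v * fb) :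
    (fa + fb - fa' - fb') * (1 + c * (fa - fb)) = c * (ea - eb) := by
  have na := left_ne_zero_of_mul_eq_one ha
  have nb := left_ne_zero_of_mul_eq_one hb
  have na' := left_ne_zero_of_mul_eq_one ha'
  have nb' := left_ne_zero_of_mul_eq_one hb'
  obtain rfl := eq_inv_of_mul_eq_one_right ha
  obtain rfl := eq_inv_of_mul_eq_one_right hb
  obtain rfl := eq_inv_of_mul_eq_one_right ha'
  obtain rfl := eq_inv_of_mul_eq_one_right hb'
  obtain rfl : ea = _ := (eq_inv_mul_iff_mul_eq₀ na).2 hea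
  obtain rfl : eb = _ := (eq_inv_mul_iff_mul_eq₀ nb).2 heb
  have hg : c * ((1 - u)⁻¹ - (1 - v)⁻¹) = 2 * (u + v) * (1 - u)⁻¹ * (1 - v)⁻¹ := by
    field_simp
    linear_combination hc
  have he : c * ((1 - u)⁻¹ * (u * (1 - u)⁻¹) - (1 - v)⁻¹ * (v * (1 - v)⁻¹))
      = 2 * (u + v) * (1 - u * v) * (1 - u)⁻¹ ^ 2 * (1 - v)⁻¹ ^ 2 := by
    field_simp
    linear_combination (1 - u * v) * hc
  rw [hg, he]
  field_simp
  ring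

theorem powerDiff_mul_pfCoeff {a b : ℂ} (h : a - b ≠ 0) :
    PowerSeries.mk (powerDiff a b) * PowerSeries.mk (pfCoeff a b)
      = euler (PowerSeries.mk (pfCoeff a b)) := by
  have hE : euler (PowerSeries.mk (pfCoeff a b)) = C (2 * (a + b) / (a - b)) *
      (euler (PowerSeries.mk (fun n => a ^ n)) - euler (PowerSeries.mk (fun n => b ^ n))) := by
    ext n
    rw [coeff_C_mul, map_sub, coeff_euler, coeff_euler, coeff_euler, mk_pfCoeff, map_add,
      coeff_C_mul, map_sub, coeff_one]
    simp only [nsmul_eq_mul]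
    split_ifs with h
    · simp [h]
    · ring
  rw [hE, mk_pfCoeff, mk_powerDiff]
  apply IsFractionRing.injective ℂ⟦X⟧ (FractionRing ℂ⟦X⟧)
  simp only [map_mul, map_add, map_sub, map_one]
  refine partial_fraction_identity (u := algebraMap ℂ⟦X⟧ _ (C a * PowerSeries.X))
    (v := algebraMap ℂ⟦X⟧ _ (C b * PowerSeries.X)) ?_ ?_ ?_ ?_ ?_ ?_ ?_
  · have hc : C (2 * (a + b) / (a - b)) * (C a * PowerSeries.X - C b * PowerSeries.X) =
        (C a * PowerSeries.X + C b * PowerSeries.X)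
          + (C a * PowerSeries.X + C b * PowerSeries.X) := by
      rw [← two_mul (C a * PowerSeries.X + C b * PowerSeries.X), ← sub_mul, ← add_mul, ← map_sub,
        ← map_add, ← mul_assoc, ← mul_assoc, ← map_ofNat C, ← map_mul, ← map_mul,
        div_mul_cancel₀ _ h]
    simpa using congrArg (algebraMap ℂ⟦X⟧ (FractionRing ℂ⟦X⟧)) hc
  · simpa using congrArg (algebraMap ℂ⟦X⟧ (FractionRing ℂ⟦X⟧)) (one_sub_mul_mk_pow a)
  · simpa using congrArg (algebraMap ℂ⟦X⟧ (FractionRing ℂ⟦X⟧)) (one_sub_mul_mk_pow b)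
  · simpa using congrArg (algebraMap ℂ⟦X⟧ (FractionRing ℂ⟦X⟧)) (one_sub_mul_mk_pow (-a))
  · simpa using congrArg (algebraMap ℂ⟦X⟧ (FractionRing ℂ⟦X⟧)) (one_sub_mul_mk_pow (-b))
  · simpa using congrArg (algebraMap ℂ⟦X⟧ (FractionRing ℂ⟦X⟧)) (euler_mk_pow a)
  · simpa using congrArg (algebraMap ℂ⟦X⟧ (FractionRing ℂ⟦X⟧)) (euler_mk_pow b)

theorem sum_powerDiff_mul_pfCoeff {a b : ℂ} (h : a - b ≠ 0) (n : ℕ) :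
    ∑ p ∈ antidiagonal n, powerDiff a b p.1 * pfCoeff a b p.2 = n * pfCoeff a b n := by
  have := congrArg (coeff n) (powerDiff_mul_pfCoeff h)
  rw [coeff_mul, coeff_euler] at this
  simpa only [coeff_mk, nsmul_eq_mul] using this

end QAff

namespace QAff

open Finset PowerSeries

section LoopModule

variable {A : Type*} [Ring A] [Algebra ℂ A]

theorem exp_mul_loop {E N : ℕ → A} {a b : ℂ} (hab : a - b ≠ 0) (h4 : a * b = -(1 / 4))
    (h0 : E 0 = 1)
    (h1 : ∀ k, E 1 * N k = N k * E 1 + (2 * (a + b)) • N (k + 1))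
    (h2 : ∀ n k, E (n + 2) * N k = N k * E (n + 2)
      + (a + b) • (E (n + 1) * N (k + 1) + N (k + 1) * E (n + 1))
      + (1 / 4 : ℂ) • (E n * N (k + 2) - N (k + 2) * E n)) (n k : ℕ) :
    E n * N k = ∑ p ∈ antidiagonal n, pfCoeff a b p.1 • (N (k + p.1) * E p.2) := by
  have g0 : pfCoeff a b 0 = 1 := if_pos rfl
  have g1 : pfCoeff a b 1 = 2 * (a + b) := by
    rw [pfCoeff, if_neg one_ne_zero, pow_one, pow_one, div_mul_cancel₀ _ hab]
  have g2 : pfCoeff a b 2 = (a + b) * pfCoeff a b 1 := by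
    rw [g1, pfCoeff, if_neg two_ne_zero]
    field_simp
    ring
  have g3 : ∀ i, pfCoeff a b (i + 3)
      = (a + b) * pfCoeff a b (i + 2) + 1 / 4 * pfCoeff a b (i + 1) := by
    intro i
    simp only [pfCoeff, if_neg (Nat.succ_ne_zero _)]
    linear_combination (2 * (a + b) / (a - b)) * (b ^ (i + 1) - a ^ (i + 1)) * h4
  induction n using Nat.twoStepInduction generalizing k with
  | zero => simp [h0, g0]
  | one =>
    rw [h1, Finset.Nat.sum_antidiagonal_succ]
    simp [h0, g0, g1]
  | more n ih0 ih1 =>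
    have hs : ∑ p ∈ antidiagonal n, pfCoeff a b (p.1 + 2) • (N (k + (p.1 + 2)) * E p.2)
        = ∑ p ∈ antidiagonal n, ((a + b) * pfCoeff a b (p.1 + 1))
            • (N (k + (p.1 + 2)) * E p.2)
          + ((1 / 4 : ℂ) • ∑ p ∈ antidiagonal n, pfCoeff a b p.1 • (N (k + (p.1 + 2)) * E p.2)
            - (1 / 4 : ℂ) • (N (k + 2) * E n)) := by
      cases n with
      | zero => simp [g0, g2]
      | succ n =>
        simp only [Finset.Nat.sum_antidiagonal_succ, zero_add, g2, g0, one_smul, smul_add,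
          Finset.smul_sum, smul_smul, add_assoc, Nat.reduceAdd, g3, add_smul,
          Finset.sum_add_distrib]
        abel
    have e1 : ∀ i, k + 1 + (i + 1) = k + (i + 2) := fun i => by omega
    have e2 : ∀ i, k + 2 + i = k + (i + 2) := fun i => by omega
    rw [h2, ih0, ih1, Finset.Nat.sum_antidiagonal_succ, Finset.Nat.sum_antidiagonal_succ,
      Finset.Nat.sum_antidiagonal_succ]
    simp only [add_assoc, zero_add, Nat.reduceAdd, g0, g1, one_smul, e1, e2, add_zero]
    simp only [← add_assoc, smul_add, smul_sub, Finset.smul_sum, smul_smul, two_mul,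
      add_smul]
    simp only [Finset.smul_sum, smul_smul, ← add_assoc] at hs
    rw [hs]
    abel

theorem log_commutator_loop {E N l : ℕ → A} {a b : ℂ} (hab : a - b ≠ 0) (h0 : E 0 = 1)
    (hE : ∀ n k, E n * N k = ∑ p ∈ antidiagonal n, pfCoeff a b p.1 • (N (k + p.1) * E p.2))
    (hl : euler (PowerSeries.mk E) = PowerSeries.mk l * PowerSeries.mk E) (n k : ℕ) :
    l n * N k - N k * l n = powerDiff a b n • N (k + n) := by
  have key : ∀ n k, ∑ p ∈ antidiagonal n,
      pfCoeff a b p.2 • (l p.1 * N (k + p.2) - N (k + p.2) * l p.1)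
        = (n * pfCoeff a b n) • N (k + n) := by
    intro n k
    set G : A⟦X⟧ := PowerSeries.mk fun i => pfCoeff a b i • N (k + i) with hG
    have h1 : PowerSeries.mk E * C (N k) = G * PowerSeries.mk E := by
      ext n
      rw [coeff_mul_C, coeff_mk, hE, coeff_mul]
      refine Finset.sum_congr rfl fun p _ => ?_
      rw [hG, coeff_mk, coeff_mk, smul_mul_assoc]
    have h2 : PowerSeries.mk l * G = euler G + G * PowerSeries.mk l := by
      apply mul_right_cancel_of_constantCoeff_eq_one (e := PowerSeries.mk E) (by simp [h0])
      have := congrArg euler h1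
      rw [euler_mul, euler_C, mul_zero, add_zero, euler_mul, hl, mul_assoc, h1] at this
      rw [mul_assoc, this, add_mul, mul_assoc]
    have h3 := congrArg (coeff n) h2
    rw [map_add, coeff_euler, coeff_mul, coeff_mul, ← Finset.Nat.sum_antidiagonal_swap (n := n)
      (f := fun p => coeff p.1 G * coeff p.2 (PowerSeries.mk l)), ← sub_eq_iff_eq_add,
      ← Finset.sum_sub_distrib] at h3
    simp only [hG, coeff_mk, Prod.fst_swap, Prod.snd_swap, smul_mul_assoc, mul_smul_comm,
      ← smul_sub] at h3
    rw [h3, mul_smul, Nat.cast_smul_eq_nsmul]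
  induction n using Nat.strong_induction_on generalizing k with
  | _ n ih =>
    have hn : (n, 0) ∈ antidiagonal n := HasAntidiagonal.mem_antidiagonal.2 (by simp)
    have h1 := key n k
    have h2 := congrArg (· • N (k + n)) (sum_powerDiff_mul_pfCoeff hab n)
    simp only [Finset.sum_smul] at h2
    rw [← h2, ← Finset.add_sum_erase _ _ hn, ← Finset.add_sum_erase _ _ hn] at h1
    have h3 : ∑ p ∈ (antidiagonal n).erase (n, 0),
        pfCoeff a b p.2 • (l p.1 * N (k + p.2) - N (k + p.2) * l p.1)
        = ∑ p ∈ (antidiagonal n).erase (n, 0),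
          (powerDiff a b p.1 * pfCoeff a b p.2) • N (k + n) := by
      refine Finset.sum_congr rfl fun p hp => ?_
      obtain ⟨hp0, hp⟩ := Finset.mem_erase.1 hp
      rw [HasAntidiagonal.mem_antidiagonal] at hp
      have : p.1 ≠ n := fun h => hp0 (Prod.ext h (by simp; omega))
      rw [ih _ (by omega), smul_smul, mul_comm, add_assoc, add_comm p.2, hp]
    rw [h3] at h1
    have h4 := add_right_cancel h1
    have g0 : pfCoeff a b 0 = 1 := if_pos rfl
    simpa only [g0, one_smul, mul_one, add_zero] using h4

end LoopModule

end QAff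

namespace QAff

open PowerSeries

section Logarithm

variable {A : Type*} [Ring A] [Algebra ℂ A]

theorem compSum_congr {l l' : ℕ → A} (h : ∀ i, 1 ≤ i → l i = l' i) (w : ℕ → ℂ) (n : ℕ) :
    compSum l w n = compSum l' w n := by
  refine Finset.sum_congr rfl fun c _ => ?_
  rw [List.map_congr_left fun i hi => h i (c.blocks_pos hi)]

theorem log_commute {E l : ℕ → A} {t : ℂ} (ht : t ≠ 0)
    (hE : ∀ n, 1 ≤ n → E n = compSum l (fun k => t ^ k / (k.factorial : ℂ)) n)
    (hc : ∀ m n, E m * E n = E n * E m) {m n : ℕ} (hm : 1 ≤ m) (hn : 1 ≤ n) :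
    l m * l n = l n * l m := by
  have hmem : ∀ n, 1 ≤ n → l n ∈ Algebra.adjoin ℂ (Set.range E) :=
    mem_of_compSum_mem (w := fun k => t ^ k / (k.factorial : ℂ)) (by simpa using ht)
      fun n hn => hE n hn ▸ Algebra.subset_adjoin ⟨n, rfl⟩
  refine Algebra.commute_of_mem_adjoin_of_forall_mem_commute (hmem n hn) ?_
  rintro _ ⟨j, rfl⟩
  refine (Algebra.commute_of_mem_adjoin_of_forall_mem_commute (hmem m hm) ?_).symm
  rintro _ ⟨i, rfl⟩
  exact hc j i

theorem log_commutator {E N l : ℕ → A} {a b t : ℂ} (ht : t ≠ 0) (hab : a - b ≠ 0)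
    (h0 : E 0 = 1)
    (hN : ∀ n k, E n * N k =
      ∑ p ∈ Finset.HasAntidiagonal.antidiagonal n, pfCoeff a b p.1 • (N (k + p.1) * E p.2))
    (hE : ∀ n, 1 ≤ n → E n = compSum l (fun k => t ^ k / (k.factorial : ℂ)) n)
    (hc : ∀ m n, E m * E n = E n * E m) {n : ℕ} (hn : 1 ≤ n) (k : ℕ) :
    l n * N k - N k * l n = (powerDiff a b n / (t * n)) • N (k + n) := by
  set l' : ℕ → A := fun n => if n = 0 then 0 else l n with hl'
  have hl : ∀ i, 1 ≤ i → l i = l' i := fun i hi => (if_neg (by omega)).symm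
  have hE' : E = compSum l' fun k => t ^ k / (k.factorial : ℂ) := by
    ext n
    cases n with
    | zero => simp [compSum_zero, h0]
    | succ n => rw [hE _ n.succ_pos, compSum_congr hl]
  have hcl : ∀ m n, Commute (l' m) (l' n) := by
    intro m n
    simp only [hl']
    split_ifs with h1 h2 h2
    · exact Commute.zero_left _
    · exact Commute.zero_left _
    · exact Commute.zero_right _
    · exact log_commute ht hE hc (by omega) (by omega)
  have heuler := euler_mk_compSum_exp (l := l') (if_pos rfl) hcl t
  rw [← hE'] at heuler
  have := log_commutator_loop hab h0 hN heuler n k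
  rw [smul_mul_assoc, mul_smul_comm, ← smul_sub, ← hl n hn] at this
  have htn : t * n ≠ 0 := mul_ne_zero ht (by exact_mod_cast (by omega : n ≠ 0))
  rw [div_eq_inv_mul, mul_smul, ← this, inv_smul_smul₀ htn]

end Logarithm

theorem powerDiff_two_mul (a b : ℂ) (j : ℕ) : powerDiff a b (2 * j) = 0 := by
  simp only [powerDiff, pow_mul, neg_sq]
  ring

theorem powerDiff_two_mul_add_one (a b : ℂ) (j : ℕ) :
    powerDiff a b (2 * j + 1) = 2 * (a ^ (2 * j + 1) + b ^ (2 * j + 1)) := by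
  simp only [powerDiff, (odd_two_mul_add_one j).neg_pow]
  ring

theorem powerDiff_div (q : ℂ) (j : ℕ) (hθ : θ q ≠ 0) :
    powerDiff (q / 2) (-(q⁻¹ / 2)) (2 * j + 1) / (θ q * (2 * j + 1 : ℕ)) =
      ((2 : ℂ) ^ (2 * j))⁻¹ * ((q ^ (2 * j + 1) - q⁻¹ ^ (2 * j + 1)) / (q - q⁻¹))
        / ((2 * j + 1 : ℕ) : ℂ) := by
  have hn : ((2 * j + 1 : ℕ) : ℂ) ≠ 0 := Nat.cast_ne_zero.2 (Nat.succ_ne_zero _)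
  rw [powerDiff_two_mul_add_one, (odd_two_mul_add_one j).neg_pow, div_pow, div_pow,
    pow_succ (2 : ℂ), ← θ]
  field_simp
  ring

theorem theta_smul_Lt_mul_M {q : ℂ} (hq0 : q ≠ 0) (hq : NotRootOfUnity q) (n k : ℕ) :
    (θ q • Lt q (2 * (n : ℤ))) * M q k = ∑ p ∈ Finset.HasAntidiagonal.antidiagonal n,
      pfCoeff (q / 2) (-(q⁻¹ / 2)) p.1 • (M q (k + p.1) * θ q • Lt q (2 * (p.2 : ℤ))) := by
  have hθ : θ q ≠ 0 := by simpa [θ] using pow_sub_inv_pow_ne_zero hq0 hq 1 one_ne_zero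
  have hab : q / 2 + -(q⁻¹ / 2) = θ q / 2 := by rw [θ]; ring
  have hab' : q / 2 - -(q⁻¹ / 2) ≠ 0 := fun h => hq 4 (by norm_num) <| by
    field_simp at h
    linear_combination (q ^ 2 - 1) * h
  refine exp_mul_loop (E := fun n : ℕ => θ q • Lt q (2 * (n : ℤ))) (N := M q) hab'
    (by field_simp; norm_num) ?_ ?_ ?_ n k
  · simp only [Nat.cast_zero, mul_zero]
    rw [Lt_zero, smul_inv_smul₀ hθ]
  · intro k
    rw [hab]
    simp only [smul_mul_assoc, mul_smul_comm]
    rw [Lt_two_mul_M' hq0 hq, smul_add, mul_div_cancel₀ _ two_ne_zero]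
  · intro n k
    rw [hab]
    simp only [smul_mul_assoc, mul_smul_comm]
    rw [Lt_two_mul_M hq0 hq]
    simp only [smul_add, smul_sub, smul_comm (θ q)]

end QAff

/-- In `U = U_q(A(0,2)^{(4)})^+`, where `Lbar j` denotes `L̄_{2j}` (see `stmt17`) and
`M q k = M_{2k+1}`:
(a) `L̄_{2m}L̄_{2n} = L̄_{2n}L̄_{2m}` for `m, n ≥ 1`;
(c) `L̄_{4j}` commutes with `M_{2n+1}` for `j ≥ 1`, `n ≥ 0`, and
`L̄_{4j+2}M_{2n+1} - M_{2n+1}L̄_{4j+2} = (1/2^{2j})([2j+1]_q/(2j+1))·M_{4j+2n+3}` for `j, n ≥ 0`. -/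
theorem stmt18 (q : ℂ) (hq0 : q ≠ 0) (hq : NotRootOfUnity q) (Lbar : ℕ → U q)
    (hLbar : ∀ n : ℕ, 1 ≤ n →
      θ q • Lt q (2*(n : ℤ))
        = ∑ c : Composition n,
            ((θ q) ^ c.length / (Nat.factorial c.length : ℂ)) •
              (c.blocks.map (fun i => Lbar i)).prod) :
    (∀ m n : ℕ, 1 ≤ m → 1 ≤ n → Lbar m * Lbar n = Lbar n * Lbar m) ∧
    (∀ n j : ℕ, 1 ≤ j → Lbar (2*j) * M q n = M q n * Lbar (2*j)) ∧
    (∀ n j : ℕ, Lbar (2*j+1) * M q n - M q n * Lbar (2*j+1)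
      = (((2 : ℂ)^(2*j))⁻¹ * ((q^(2*j+1) - (q⁻¹)^(2*j+1)) / (q - q⁻¹)) / ((2*j+1 : ℕ) : ℂ))
          • M q (2*j + 1 + n)) := by
  have hθ : θ q ≠ 0 := by simpa [θ] using pow_sub_inv_pow_ne_zero hq0 hq 1 one_ne_zero
  have hab : q / 2 - -(q⁻¹ / 2) ≠ 0 := fun h => hq 4 (by norm_num) <| by
    field_simp at h
    linear_combination (q ^ 2 - 1) * h
  have h0 : (fun n : ℕ => θ q • Lt q (2 * (n : ℤ))) 0 = 1 := by
    simp only [Nat.cast_zero, mul_zero]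
    rw [Lt_zero, smul_inv_smul₀ hθ]
  have hc (m n : ℕ) : (θ q • Lt q (2 * (m : ℤ))) * (θ q • Lt q (2 * (n : ℤ)))
      = (θ q • Lt q (2 * (n : ℤ))) * (θ q • Lt q (2 * (m : ℤ))) := by
    simp only [smul_mul_assoc, mul_smul_comm]
    rw [Lt_comm hq0 hq]
  have hM {n : ℕ} (hn : 1 ≤ n) (k : ℕ) :=
    log_commutator hθ hab h0 (theta_smul_Lt_mul_M hq0 hq) hLbar hc hn k
  refine ⟨fun m n hm hn => log_commute hθ hLbar hc hm hn, fun n j hj => ?_, fun n j => ?_⟩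
  · have := hM (by omega : 1 ≤ 2 * j) n
    rw [powerDiff_two_mul, zero_div, zero_smul] at this
    exact sub_eq_zero.1 this
  · rw [hM (by omega) n, powerDiff_div q j hθ, add_comm n]
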